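/- arXiv:1309.0055 — 4 statements merged into one kernel-verified Lean document; each statement's English description precedes it below -/
import Mathlib

section
/- Let f be a real entire function admitting the representation f(z) = C·e^{−az²+bz}·z^m·∏_{k=1}^{ω}(1 − z/z_k)e^{z/z_k} (0 ≤ ω ≤ ∞, the product converging locally uniformly), where C ∈ ℝ\{0}, a ≥ 0, b ∈ ℝ, m ∈ ℕ₀, every z_k is real and nonzero, and ∑_k 1/z_k² < ∞ (i.e. f belongs to the Laguerre–Pólya class). Then Lₙ(x; f) ≥ 0 for every n ∈ ℕ₀ and every x ∈ ℝ. -/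
open ComplexOrder

/-- The `n`-th generalized Laguerre expression
`Lₙ(x; f) := ∑_{j=0}^{2n} ((−1)^{j+n}/(2n)!)·C(2n,j)·f^{(j)}(x)·f^{(2n−j)}(x)`. -/
noncomputable def Lag (f : ℂ → ℂ) (n : ℕ) (x : ℂ) : ℂ :=
  ∑ j ∈ Finset.range (2 * n + 1),
    (-1 : ℂ) ^ (j + n) / (Nat.factorial (2 * n)) * (Nat.choose (2 * n) j) *
      iteratedDeriv j f x * iteratedDeriv (2 * n - j) f x

/-- Entire with nonnegative Taylor coefficients at `0`. -/
def NNC (g : ℂ → ℂ) : Prop := Differentiable ℂ g ∧ ∀ n, 0 ≤ iteratedDeriv n g 0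

/-- Symmetrization `t ↦ f (x + i t) f (x - i t)`. -/
noncomputable def Sy (x : ℝ) (f : ℂ → ℂ) : ℂ → ℂ :=
  fun t => f (x + Complex.I * t) * f (x + (-Complex.I) * t)

lemma NNC.mul {f g : ℂ → ℂ} (hf : NNC f) (hg : NNC g) : NNC (fun t => f t * g t) := by
  refine ⟨hf.1.mul hg.1, fun n => ?_⟩
  have := iteratedDeriv_mul (n := n) (x := (0:ℂ)) (hf.1.contDiff.contDiffAt) (hg.1.contDiff.contDiffAt)
  change 0 ≤ iteratedDeriv n (f * g) 0
  rw [this]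
  refine Finset.sum_nonneg fun i _ => ?_
  refine mul_nonneg (mul_nonneg ?_ (hf.2 _)) (hg.2 _)
  exact Nat.cast_nonneg _

lemma NNC.add {f g : ℂ → ℂ} (hf : NNC f) (hg : NNC g) : NNC (fun t => f t + g t) := by
  refine ⟨hf.1.add hg.1, fun n => ?_⟩
  have := iteratedDeriv_add (n := n) (x := (0:ℂ)) (hf.1.contDiff.contDiffAt) (hg.1.contDiff.contDiffAt)
  change 0 ≤ iteratedDeriv n (f + g) 0
  rw [this]
  exact add_nonneg (hf.2 _) (hg.2 _)

lemma NNC.const {c : ℂ} (hc : 0 ≤ c) : NNC (fun _ => c) := by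
  refine ⟨differentiable_const _, fun n => ?_⟩
  rw [iteratedDeriv_const]
  split_ifs <;> simp [hc]

lemma NNC.id : NNC (fun t => t) := by
  refine ⟨differentiable_id, fun n => ?_⟩
  change 0 ≤ iteratedDeriv n _root_.id 0
  rw [iteratedDeriv_id]
  split_ifs <;> simp

lemma NNC.quad {c d : ℝ} (hc : 0 ≤ c) (hd : 0 ≤ d) : NNC (fun t => (c : ℂ) + d * (t * t)) :=
  (NNC.const (by exact_mod_cast hc)).add
    ((NNC.const (by exact_mod_cast hd)).mul (NNC.id.mul NNC.id))

lemma NNC.expsq {a : ℝ} (ha : 0 ≤ a) : NNC (fun t => Complex.exp (a * t ^ 2)) := by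
  have hd : Differentiable ℂ (fun t : ℂ => Complex.exp (a * t ^ 2)) := by fun_prop
  refine ⟨hd, fun n => ?_⟩
  induction n using Nat.strong_induction_on with
  | _ n ih =>
    rcases n with _ | n
    · simp
    · have hder : deriv (fun t : ℂ => Complex.exp (a * t ^ 2)) =
          (fun t => ((2 * a : ℝ) : ℂ) * t) * (fun t : ℂ => Complex.exp (a * t ^ 2)) := by
        funext t
        have h1 : HasDerivAt (fun t : ℂ => (a:ℂ) * t ^ 2) (a * (2 * t)) t := by
          simpa using (hasDerivAt_pow 2 t).const_mul (a : ℂ)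
        rw [h1.cexp.deriv]
        simp; ring
      have hlin : NNC (fun t => ((2 * a : ℝ) : ℂ) * t) :=
        (NNC.const (by exact_mod_cast (by positivity : 0 ≤ 2 * a))).mul NNC.id
      rw [iteratedDeriv_succ', hder, iteratedDeriv_mul hlin.1.contDiff.contDiffAt
        hd.contDiff.contDiffAt]
      refine Finset.sum_nonneg fun i _ => ?_
      refine mul_nonneg (mul_nonneg ?_ (hlin.2 _)) (ih _ (by omega))
      exact Nat.cast_nonneg _

lemma Sy_mul {x : ℝ} {f g : ℂ → ℂ} (hf : NNC (Sy x f)) (hg : NNC (Sy x g)) :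
    NNC (Sy x (fun z => f z * g z)) := by
  convert hf.mul hg using 2 with t
  simp only [Sy]; ring

lemma Sy_const (x C : ℝ) : NNC (Sy x (fun _ => (C : ℂ))) := by
  unfold Sy
  refine NNC.const ?_
  exact_mod_cast mul_self_nonneg C

lemma Sy_id (x : ℝ) : NNC (Sy x (fun z => z)) := by
  convert NNC.quad (mul_self_nonneg x) (zero_le_one) using 2 with t
  simp only [Sy]; push_cast
  linear_combination (-t^2) * Complex.I_sq

lemma Sy_pow (x : ℝ) (m : ℕ) : NNC (Sy x (fun z => z ^ m)) := by
  induction m with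
  | zero => simpa using Sy_const x 1
  | succ m ih => simpa only [pow_succ] using Sy_mul ih (Sy_id x)

lemma Sy_exp (x : ℝ) {a : ℝ} (b : ℝ) (ha : 0 ≤ a) :
    NNC (Sy x (fun z => Complex.exp (-(a : ℂ) * z ^ 2 + (b : ℂ) * z))) := by
  have h1 : NNC (fun _ => ((Real.exp (2 * b * x - 2 * a * x ^ 2) : ℝ) : ℂ)) :=
    NNC.const (by exact_mod_cast (Real.exp_pos _).le)
  have h2 : NNC (fun t => Complex.exp ((2 * a : ℝ) * t ^ 2)) := NNC.expsq (by positivity)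
  convert h1.mul h2 using 2 with t
  simp only [Sy]
  rw [Complex.ofReal_exp, ← Complex.exp_add, ← Complex.exp_add]
  congr 1
  push_cast
  linear_combination (-2 * a * t^2) * Complex.I_sq

lemma Sy_factor (x w : ℝ) :
    NNC (Sy x (fun z => (1 - z * w) * Complex.exp (z * w))) := by
  refine Sy_mul ?_ ?_
  · convert NNC.quad (mul_self_nonneg (1 - x * w)) (mul_self_nonneg w) using 2 with t
    simp only [Sy]; push_cast
    linear_combination (-t^2 * w^2) * Complex.I_sq
  · simpa [mul_comm] using Sy_exp x w le_rfl

lemma Sy_prod (x : ℝ) (w : ℕ → ℝ) (N : ℕ) :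
    NNC (Sy x (fun z => ∏ k ∈ Finset.range N, (1 - z * w k) * Complex.exp (z * w k))) := by
  induction N with
  | zero => simpa using Sy_const x 1
  | succ N ih => simpa only [Finset.prod_range_succ] using Sy_mul ih (Sy_factor x (w N))

lemma iteratedDeriv_aff {f : ℂ → ℂ} (hf : Differentiable ℂ f) (x c : ℂ) (n : ℕ) :
    iteratedDeriv n (fun t => f (x + c * t)) 0 = c ^ n * iteratedDeriv n f x := by
  have hd : Differentiable ℂ (fun s => f (x + s)) := by fun_prop
  rw [iteratedDeriv_comp_const_mul (f := fun s => f (x + s)) hd.contDiff c]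
  simp [iteratedDeriv_comp_const_add]

lemma Sy_deriv {f : ℂ → ℂ} (hf : Differentiable ℂ f) (x : ℝ) (n : ℕ) :
    iteratedDeriv n (Sy x f) 0 = ∑ j ∈ Finset.range (n + 1), (n.choose j : ℂ) *
      (Complex.I ^ j * iteratedDeriv j f x) *
        ((-Complex.I) ^ (n - j) * iteratedDeriv (n - j) f x) := by
  have h1 : Differentiable ℂ (fun t : ℂ => f (x + Complex.I * t)) := by fun_prop
  have h2 : Differentiable ℂ (fun t : ℂ => f (x + (-Complex.I) * t)) := by fun_prop
  have := iteratedDeriv_mul (n := n) (x := (0:ℂ)) (h1.contDiff.contDiffAt) (h2.contDiff.contDiffAt)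
  change iteratedDeriv n ((fun t : ℂ => f (x + Complex.I * t)) *
    (fun t : ℂ => f (x + (-Complex.I) * t))) 0 = _
  rw [this]
  simp only [iteratedDeriv_aff hf]

lemma Lag_eq {f : ℂ → ℂ} (hf : Differentiable ℂ f) (x : ℝ) (n : ℕ) :
    Lag f n x = ((1 / (Nat.factorial (2 * n)) : ℝ) : ℂ) * iteratedDeriv (2 * n) (Sy x f) 0 := by
  rw [Sy_deriv hf, Lag, Finset.mul_sum]
  refine Finset.sum_congr rfl fun j hj => ?_
  have hj' : j ≤ 2 * n := by simpa [Nat.lt_succ_iff] using hj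
  have key : (-1 : ℂ) ^ (j + n) = Complex.I ^ j * (-Complex.I) ^ (2 * n - j) := by
    obtain ⟨k, hk⟩ := Nat.exists_eq_add_of_le hj'
    have e : 2 * n - j = k := by omega
    rw [e, neg_pow Complex.I]
    have h3 : Complex.I ^ j * ((-1) ^ k * Complex.I ^ k) = (-1) ^ k * Complex.I ^ (2 * n) := by
      rw [hk, pow_add]; ring
    rw [h3, pow_mul, Complex.I_sq, pow_add]
    congr 1
    have h4 : (-1 : ℂ) ^ (j + k) = 1 := by rw [← hk, pow_mul]; simp
    rw [pow_add] at h4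
    have h5 : (-1 : ℂ) ^ k * (-1) ^ k = 1 := by rw [← mul_pow]; simp
    calc (-1 : ℂ) ^ j = (-1 : ℂ) ^ j * ((-1 : ℂ) ^ k * (-1) ^ k) := by rw [h5, mul_one]
      _ = _ := by rw [← mul_assoc, h4, one_mul]
  rw [key]
  push_cast
  ring

lemma tlu_iteratedDeriv {F : ℕ → ℂ → ℂ} {f : ℂ → ℂ}
    (h : TendstoLocallyUniformlyOn F f Filter.atTop Set.univ) (hF : ∀ N, Differentiable ℂ (F N))
    (n : ℕ) :
    TendstoLocallyUniformlyOn (fun N => iteratedDeriv n (F N)) (iteratedDeriv n f)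
      Filter.atTop Set.univ := by
  induction n with
  | zero => simpa using h
  | succ n ih =>
    simp only [iteratedDeriv_succ]
    refine ih.deriv (Filter.Eventually.of_forall fun N => ?_) isOpen_univ
    exact (((hF N).contDiff (n := ⊤)).differentiable_iteratedDeriv n
      (WithTop.coe_lt_top _)).differentiableOn

lemma Sy_lim {F : ℕ → ℂ → ℂ} {f : ℂ → ℂ} {x : ℝ}
    (h : TendstoLocallyUniformlyOn F f Filter.atTop Set.univ) (hF : ∀ N, Differentiable ℂ (F N))
    (hN : ∀ N, NNC (Sy x (F N))) : NNC (Sy x f) := by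
  have hf : Differentiable ℂ f := differentiableOn_univ.1
    (h.differentiableOn (Filter.Eventually.of_forall fun N => (hF N).differentiableOn) isOpen_univ)
  refine ⟨by unfold Sy; fun_prop, fun n => ?_⟩
  have ht : Filter.Tendsto (fun N => iteratedDeriv n (Sy x (F N)) 0) Filter.atTop
      (nhds (iteratedDeriv n (Sy x f) 0)) := by
    simp only [Sy_deriv hf, Sy_deriv (hF _)]
    refine tendsto_finsetSum _ fun j _ => ?_
    have ha := (tlu_iteratedDeriv h hF j).tendsto_at (Set.mem_univ (x : ℂ))
    have hb := (tlu_iteratedDeriv h hF (n - j)).tendsto_at (Set.mem_univ (x : ℂ))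
    exact ((ha.const_mul _).const_mul _).mul (hb.const_mul _)
  exact ge_of_tendsto' ht fun N => (hN N).2 n

lemma factor_bound {u : ℂ} (hu : ‖u‖ ≤ 1) : ‖(1 - u) * Complex.exp u - 1‖ ≤ 3 * ‖u‖ ^ 2 := by
  have e : (1 - u) * Complex.exp u - 1 = (1 - u) * (Complex.exp u - 1 - u) - u ^ 2 := by ring
  have h1 := Complex.norm_exp_sub_one_sub_id_le hu
  have h2 : ‖1 - u‖ ≤ 2 := (norm_sub_le _ _).trans (by rw [norm_one]; linarith)
  rw [e]
  refine (norm_sub_le _ _).trans ?_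
  rw [norm_mul, norm_pow]
  have := mul_le_mul h2 h1 (norm_nonneg _) (by norm_num)
  linarith

lemma prod_tlu (w : ℕ → ℂ) (hsum : Summable fun k => ‖w k‖ ^ 2) :
    TendstoLocallyUniformlyOn
      (fun N z => ∏ k ∈ Finset.range N, (1 - z * w k) * Complex.exp (z * w k))
      (fun z => ∏' k, (1 - z * w k) * Complex.exp (z * w k)) Filter.atTop Set.univ := by
  have hR : ∀ R : ℝ, 0 < R → TendstoLocallyUniformlyOn
      (fun N z => ∏ k ∈ Finset.range N, (1 - z * w k) * Complex.exp (z * w k))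
      (fun z => ∏' k, (1 - z * w k) * Complex.exp (z * w k)) Filter.atTop (Metric.ball 0 R) := by
    intro R hR
    have hu : Summable fun k => 3 * (R ^ 2 * ‖w k‖ ^ 2) := (hsum.mul_left _).mul_left _
    have hz : ∀ᶠ k in Filter.atTop, R ^ 2 * ‖w k‖ ^ 2 < 1 :=
      (hsum.mul_left (R ^ 2)).tendsto_atTop_zero.eventually_lt_const one_pos
    have := Summable.hasProdLocallyUniformlyOn_nat_one_add
      (f := fun k z => (1 - z * w k) * Complex.exp (z * w k) - 1)
      (K := Metric.ball (0:ℂ) R) Metric.isOpen_ball hu ?_ ?_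
    · have := this.tendstoLocallyUniformlyOn_finsetRange
      simpa only [add_sub_cancel] using this
    · filter_upwards [hz] with k hk z hz
      have hz' : ‖z‖ ≤ R := (mem_ball_zero_iff.1 hz).le
      have h1 : ‖z * w k‖ ^ 2 ≤ R ^ 2 * ‖w k‖ ^ 2 := by
        rw [norm_mul, mul_pow]; gcongr
      have h2 : ‖z * w k‖ ≤ 1 := by
        have := norm_nonneg (z * w k)
        nlinarith
      exact (factor_bound h2).trans (by linarith)
    · intro k
      fun_prop
  intro u hu z _
  have hzm : z ∈ Metric.ball (0:ℂ) (‖z‖ + 1) := by simp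
  obtain ⟨t, ht, h⟩ := hR (‖z‖ + 1) (by positivity) u hu z hzm
  refine ⟨t, ?_, h⟩
  rw [Metric.isOpen_ball.nhdsWithin_eq hzm] at ht
  simpa using ht

/-- **Theorem 2.4, necessity.** If `f` is in the Laguerre–Pólya class, i.e. `f` is a real
entire function with the representation
`f(z) = C·e^{−az²+bz}·z^m·∏ₖ (1 − z/zₖ)e^{z/zₖ}` where `C ≠ 0`, `a ≥ 0`, `b ∈ ℝ`,
all the zeros `zₖ` (recorded via their reciprocals `w k = 1/zₖ`, with `w k = 0` allowed so
that the product may be finite) are real and nonzero, and `∑ 1/zₖ² < ∞`, then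
`Lₙ(x; f) ≥ 0` for all `n ∈ ℕ₀` and all `x ∈ ℝ`. -/
theorem thm_2_4_necessity (f : ℂ → ℂ) (C a b : ℝ) (m : ℕ) (w : ℕ → ℂ)
    (hent : Differentiable ℂ f)
    (hreal : ∀ x : ℝ, (f x).im = 0)
    (hC : C ≠ 0) (ha : 0 ≤ a)
    (hmul : ∀ z : ℂ, Multipliable fun k => (1 - z * w k) * Complex.exp (z * w k))
    (hrep : ∀ z : ℂ, f z =
      (C : ℂ) * Complex.exp (-(a : ℂ) * z ^ 2 + (b : ℂ) * z) * z ^ m *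
        ∏' k, (1 - z * w k) * Complex.exp (z * w k))
    (hzreal : ∀ k, (w k).im = 0)
    (hsum : Summable fun k => ‖w k‖ ^ 2) :
    ∀ (n : ℕ) (x : ℝ), 0 ≤ Lag f n x := by
  intro n x
  obtain ⟨v, rfl⟩ : ∃ v : ℕ → ℝ, w = fun k => (v k : ℂ) :=
    ⟨fun k => (w k).re, funext fun k => Complex.ext (by simp) (by simp [hzreal k])⟩
  have hP := Sy_lim (x := x) (prod_tlu _ hsum) (fun N => by fun_prop) (fun N => Sy_prod x v N)
  have hS := Sy_mul (Sy_mul (Sy_mul (Sy_const x C) (Sy_exp x b ha)) (Sy_pow x m)) hP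
  rw [← funext hrep] at hS
  rw [Lag_eq hent]
  refine mul_nonneg ?_ (hS.2 _)
  exact_mod_cast (by positivity : (0:ℝ) ≤ 1 / (Nat.factorial (2 * n)))
end

section
/- Let φ be an admissible kernel and define f(t) := ∫_{−∞}^{∞} φ(x)·cos(xt) dx. Then φ is positive definite if and only if f(t) ≥ 0 for every t ∈ ℝ. -/
open ComplexOrder

/-- A function `K : ℝ → ℝ` is an admissible kernel if it is smooth, positive, even,
strictly decreasing on `(0, ∞)`, and all of its derivatives decay like
`exp(−|t|^{2+ε})` for some `ε > 0` as `|t| → ∞`. -/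
def AdmissibleKernel (K : ℝ → ℝ) : Prop :=
  ContDiff ℝ (⊤ : ℕ∞) K ∧ (∀ t : ℝ, 0 < K t) ∧ (∀ t : ℝ, K (-t) = K t) ∧
    (∀ t : ℝ, 0 < t → deriv K t < 0) ∧
    ∃ ε : ℝ, 0 < ε ∧ ∀ n : ℕ,
      (iteratedDeriv n K) =O[Filter.cocompact ℝ] fun t => Real.exp (-|t| ^ (2 + ε))

/-- A continuous function `φ : ℝ → ℝ` is positive definite if every Hermitian form
`∑ⱼ∑ₖ φ(xⱼ − xₖ)·ρⱼ·conj(ρₖ)` is a nonnegative real number. -/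
def PosDefKernel (φ : ℝ → ℝ) : Prop :=
  Continuous φ ∧ ∀ (n : ℕ) (x : Fin n → ℝ) (ρ : Fin n → ℂ),
    0 ≤ ∑ j, ∑ k, (φ (x j - x k) : ℂ) * ρ j * (starRingEnd ℂ) (ρ k)

open MeasureTheory Filter Topology ProbabilityTheory
open scoped NNReal FourierTransform SchwartzMap

/-- real finset form of positive definiteness after modulation -/
lemma pd_finset {φ : ℝ → ℝ} (h : PosDefKernel φ) (t : ℝ) (T : Finset ℝ) (c : ℝ → ℝ) :
    0 ≤ ∑ a ∈ T, ∑ b ∈ T, c a * c b * (φ (a - b) * Real.cos ((a - b) * t)) := by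
  classical
  have key := h.2 T.card (fun j => (T.equivFin.symm j : ℝ))
    (fun j => (c (T.equivFin.symm j : ℝ) : ℂ) *
      Complex.exp (((T.equivFin.symm j : ℝ) * t : ℝ) * Complex.I))
  have key2 := (Complex.le_def.1 key).1
  have e : ∀ G : ℝ → ℝ → ℝ, ∑ a ∈ T, ∑ b ∈ T, G a b =
      ∑ j, ∑ k, G (T.equivFin.symm j : ℝ) (T.equivFin.symm k : ℝ) := by
    intro G
    rw [← Finset.sum_coe_sort T, ← Equiv.sum_comp T.equivFin.symm]
    refine Finset.sum_congr rfl fun j _ => ?_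
    rw [← Finset.sum_coe_sort T, ← Equiv.sum_comp T.equivFin.symm]
  rw [e]
  rw [Complex.re_sum] at key2
  simp_rw [Complex.re_sum] at key2
  refine le_trans key2 (le_of_eq ?_)
  refine Finset.sum_congr rfl fun j _ => Finset.sum_congr rfl fun k _ => ?_
  generalize (T.equivFin.symm j : ℝ) = a
  generalize (T.equivFin.symm k : ℝ) = b
  simp only [map_mul, Complex.conj_ofReal, Complex.mul_re, Complex.mul_im, Complex.conj_re,
    Complex.conj_im, Complex.ofReal_re, Complex.ofReal_im, Complex.exp_ofReal_mul_I_re,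
    Complex.exp_ofReal_mul_I_im, sub_mul a b t, Real.cos_sub]
  ring

lemma integral_comp_simple (μ : Measure ℝ) [IsFiniteMeasure μ] (s : SimpleFunc ℝ ℝ) (F : ℝ → ℝ) :
    ∫ x, F (s x) ∂μ = ∑ a ∈ s.range, μ.real (s ⁻¹' {a}) * F a := by
  classical
  have h : (fun x => F (s x)) =
      fun x => ∑ a ∈ s.range, (s ⁻¹' {a}).indicator (fun _ => F a) x := by
    ext x
    rw [Finset.sum_eq_single (s x)]
    · simp
    · intro b _ hb
      simp [Ne.symm hb]
    · intro hx
      exact absurd (s.mem_range_self x) hx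
  rw [h, integral_finsetSum]
  · refine Finset.sum_congr rfl fun a _ => ?_
    rw [integral_indicator_const _ (s.measurableSet_fiber a), smul_eq_mul]
  · intro a _
    exact (integrable_const _).indicator (s.measurableSet_fiber a)

lemma pd_integral (ψ : ℝ → ℝ) (hc : Continuous ψ) (C : ℝ) (hC : ∀ x, ‖ψ x‖ ≤ C)
    (hpd : ∀ (T : Finset ℝ) (c : ℝ → ℝ), 0 ≤ ∑ a ∈ T, ∑ b ∈ T, c a * c b * ψ (a - b))
    (μ : Measure ℝ) [IsProbabilityMeasure μ] : 0 ≤ ∫ x, ∫ y, ψ (x - y) ∂μ ∂μ := by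
  let s : ℕ → SimpleFunc ℝ ℝ :=
    fun n => SimpleFunc.approxOn id measurable_id Set.univ 0 (Set.mem_univ _) n
  have hs : ∀ x, Tendsto (fun n => s n x) atTop (𝓝 x) := fun x =>
    SimpleFunc.tendsto_approxOn measurable_id (Set.mem_univ _) (by simp)
  have hn : ∀ n, 0 ≤ ∫ x, ∫ y, ψ (s n x - s n y) ∂μ ∂μ := by
    intro n
    rw [integral_comp_simple μ (s n) (fun a => ∫ y, ψ (a - s n y) ∂μ)]
    have := hpd (s n).range (fun a => μ.real (s n ⁻¹' {a}))
    refine this.trans (le_of_eq ?_)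
    refine Finset.sum_congr rfl fun a _ => ?_
    rw [integral_comp_simple μ (s n) (fun b => ψ (a - b)), Finset.mul_sum]
    exact Finset.sum_congr rfl fun b _ => by ring
  have hlim : Tendsto (fun n => ∫ x, ∫ y, ψ (s n x - s n y) ∂μ ∂μ) atTop
      (𝓝 (∫ x, ∫ y, ψ (x - y) ∂μ ∂μ)) := by
    refine tendsto_integral_of_dominated_convergence (fun _ => C) ?_ (integrable_const _) ?_ ?_
    · intro n
      exact (((s n).map (fun a => ∫ y, ψ (a - s n y) ∂μ)).measurable).aestronglyMeasurable
    · intro n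
      refine ae_of_all _ fun x => ?_
      refine (norm_integral_le_of_norm_le_const (ae_of_all _ fun y => hC _)).trans ?_
      simp
    · refine ae_of_all _ fun x => ?_
      refine tendsto_integral_of_dominated_convergence (fun _ => C) ?_ (integrable_const _) ?_ ?_
      · intro n
        exact (hc.measurable.comp ((measurable_const).sub (s n).measurable)).aestronglyMeasurable
      · intro n
        exact ae_of_all _ fun y => hC _
      · exact ae_of_all _ fun y => (hc.tendsto _).comp ((hs x).sub (hs y))
  exact ge_of_tendsto' hlim hn

lemma pd_lebesgue (ψ : ℝ → ℝ) (hc : Continuous ψ) (C : ℝ) (hC : ∀ x, ‖ψ x‖ ≤ C)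
    (hi : Integrable ψ)
    (hpd : ∀ (T : Finset ℝ) (c : ℝ → ℝ), 0 ≤ ∑ a ∈ T, ∑ b ∈ T, c a * c b * ψ (a - b)) :
    0 ≤ ∫ x, ψ x := by
  have h1 : ∀ v : ℝ≥0, 0 ≤ ∫ x, ψ x ∂(gaussianReal 0 (v + v)) := by
    intro v
    have h := pd_integral ψ hc C hC hpd (gaussianReal 0 v)
    have e := gaussianReal_conv_gaussianReal (m₁ := 0) (m₂ := 0) (v₁ := v) (v₂ := v)
    rw [add_zero] at e
    rw [← e, integral_conv]
    · refine h.trans (le_of_eq ?_)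
      congr 1
      ext x
      have e2 : gaussianReal 0 v = (gaussianReal 0 v).map (fun x => -x) := by
        rw [gaussianReal_map_neg, neg_zero]
      conv_rhs => rw [e2]
      rw [integral_map (by fun_prop) (by fun_prop)]
      simp [sub_eq_add_neg]
    · rw [e]
      exact Integrable.of_bound (by fun_prop) C (ae_of_all _ hC)
  have h2 : ∀ n : ℕ, 0 ≤ ∫ x, Real.exp (-x ^ 2 / (2 * ((n : ℝ) + 1 + (n + 1)))) * ψ x := by
    intro n
    have h := h1 ((n : ℝ≥0) + 1)
    rw [integral_gaussianReal_eq_integral_smul (by positivity)] at h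
    simp only [gaussianPDFReal, smul_eq_mul, mul_assoc, integral_const_mul, sub_zero] at h
    rw [mul_nonneg_iff_of_pos_left (by positivity)] at h
    simpa using h
  refine ge_of_tendsto' (f := fun n : ℕ =>
    ∫ x, Real.exp (-x ^ 2 / (2 * ((n : ℝ) + 1 + (n + 1)))) * ψ x) (x := atTop) ?_ h2
  refine tendsto_integral_of_dominated_convergence (fun x => ‖ψ x‖) ?_ hi.norm ?_ ?_
  · intro n
    exact (by fun_prop : Continuous _).aestronglyMeasurable
  · intro n
    refine ae_of_all _ fun x => ?_
    rw [norm_mul]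
    refine mul_le_of_le_one_left (norm_nonneg _) ?_
    rw [Real.norm_eq_abs, Real.abs_exp, Real.exp_le_one_iff]
    exact div_nonpos_of_nonpos_of_nonneg (by nlinarith [sq_nonneg x]) (by positivity)
  · refine ae_of_all _ fun x => ?_
    have : Tendsto (fun n : ℕ => -x ^ 2 / (2 * ((n : ℝ) + 1 + (n + 1)))) atTop (𝓝 0) := by
      refine Tendsto.div_atTop tendsto_const_nhds ?_
      refine tendsto_atTop_mono (fun n => ?_) tendsto_natCast_atTop_atTop
      have : (0 : ℝ) ≤ n := Nat.cast_nonneg n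
      linarith
    have h4 := ((Real.continuous_exp.tendsto _).comp this).mul_const (ψ x)
    simpa using h4

lemma decay_aux (ε : ℝ) (hε : 0 < ε) (k : ℕ) :
    ∀ᶠ t in cocompact ℝ, |t| ^ k * Real.exp (-|t| ^ (2 + ε)) ≤ 1 := by
  have h1 : ∀ᶠ x : ℝ in atTop, x ^ k * Real.exp (-x) < 1 :=
    (Real.tendsto_pow_mul_exp_neg_atTop_nhds_zero k).eventually_lt_const one_pos
  have h2 := (tendsto_norm_cocompact_atTop (E := ℝ)).eventually (h1.and (eventually_ge_atTop 1))
  filter_upwards [h2] with t ht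
  rw [Real.norm_eq_abs] at ht
  refine le_trans ?_ ht.1.le
  gcongr
  exact Real.self_le_rpow_of_one_le ht.2 (by linarith)

lemma exists_schwartz {φ : ℝ → ℝ} (hφ : AdmissibleKernel φ) :
    ∃ S : 𝓢(ℝ, ℝ), ∀ x, S x = φ x := by
  obtain ⟨hsm, -, -, -, ε, hε, hd⟩ := hφ
  refine ⟨⟨φ, hsm, ?_⟩, fun x => rfl⟩
  intro k n
  simp_rw [norm_iteratedFDeriv_eq_norm_iteratedDeriv]
  obtain ⟨c, hc, hb⟩ := (hd n).exists_pos
  have hev : ∀ᶠ x in cocompact ℝ, ‖x‖ ^ k * ‖iteratedDeriv n φ x‖ ≤ c := by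
    filter_upwards [hb.bound, decay_aux ε hε k] with x h1 h2
    rw [Real.norm_eq_abs (Real.exp _), Real.abs_exp] at h1
    calc ‖x‖ ^ k * ‖iteratedDeriv n φ x‖ ≤ ‖x‖ ^ k * (c * Real.exp (-|x| ^ (2 + ε))) := by gcongr
      _ = c * (|x| ^ k * Real.exp (-|x| ^ (2 + ε))) := by rw [Real.norm_eq_abs]; ring
      _ ≤ c * 1 := by gcongr
      _ = c := mul_one c
  obtain ⟨K, hK, hKs⟩ := mem_cocompact.1 hev
  have hcont : Continuous fun x => ‖x‖ ^ k * ‖iteratedDeriv n φ x‖ := by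
    have := hsm.continuous_iteratedDeriv n (by exact_mod_cast le_top)
    fun_prop
  obtain ⟨M, hM⟩ := hK.bddAbove_image hcont.continuousOn
  refine ⟨max c M, fun x => ?_⟩
  by_cases hx : x ∈ K
  · exact (hM ⟨x, hx, rfl⟩).trans (le_max_right _ _)
  · exact (hKs hx : _ ≤ c).trans (le_max_left _ _)

lemma fourier_even {φ : ℝ → ℝ} (hi : Integrable φ) (he : ∀ t, φ (-t) = φ t) (w : ℝ) :
    𝓕 (fun x => (φ x : ℂ)) w = ((∫ x, φ x * Real.cos (x * (2 * Real.pi * w)) : ℝ) : ℂ) := by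
  have hI1 : Integrable fun x => φ x * Real.cos (x * (2 * Real.pi * w)) :=
    hi.mul_bdd (c := 1) (by fun_prop) (ae_of_all _ fun x => Real.abs_cos_le_one _)
  have hI2 : Integrable fun x => φ x * Real.sin (x * (2 * Real.pi * w)) :=
    hi.mul_bdd (c := 1) (by fun_prop) (ae_of_all _ fun x => Real.abs_sin_le_one _)
  have hodd : ∫ x, φ x * Real.sin (x * (2 * Real.pi * w)) = 0 := by
    have h := integral_neg_eq_self (fun x => φ x * Real.sin (x * (2 * Real.pi * w))) volume
    simp only [he, neg_mul, Real.sin_neg, mul_neg, integral_neg] at h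
    linarith
  rw [Real.fourier_eq']
  have : ∀ v : ℝ, Complex.exp (((-2 * Real.pi * inner ℝ v w : ℝ) : ℂ) * Complex.I) • (φ v : ℂ) =
      ((φ v * Real.cos (v * (2 * Real.pi * w)) : ℝ) : ℂ) -
        ((φ v * Real.sin (v * (2 * Real.pi * w)) : ℝ) : ℂ) * Complex.I := by
    intro v
    have e : -2 * Real.pi * inner ℝ v w = - (v * (2 * Real.pi * w)) := by
      simp; ring
    rw [e, Complex.exp_mul_I, ← Complex.ofReal_cos, ← Complex.ofReal_sin, Real.cos_neg,
      Real.sin_neg, smul_eq_mul]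
    push_cast
    ring
  simp_rw [this]
  rw [integral_sub hI1.ofReal (hI2.ofReal.mul_const _), integral_mul_const, integral_complex_ofReal,
    integral_complex_ofReal, hodd]
  simp

lemma pd_of_nonneg {φ : ℝ → ℝ} (hφ : AdmissibleKernel φ)
    (hf : ∀ t : ℝ, 0 ≤ ∫ x : ℝ, φ x * Real.cos (x * t)) : PosDefKernel φ := by
  obtain ⟨S, hS⟩ := exists_schwartz hφ
  refine ⟨hφ.1.continuous, fun n x ρ => ?_⟩
  have hi : Integrable φ := by
    have := S.integrable (μ := volume)
    exact this.congr (ae_of_all _ hS)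
  let Z : 𝓢(ℝ, ℂ) := S.postcompCLM Complex.ofRealCLM
  have hZ : (Z : ℝ → ℂ) = fun x => (φ x : ℂ) := by
    ext x; simp [Z, hS]
  set g : ℝ → ℝ := fun w => ∫ x, φ x * Real.cos (x * (2 * Real.pi * w)) with hg
  have hF : ∀ w, 𝓕 Z w = (g w : ℂ) := by
    intro w
    rw [SchwartzMap.fourier_coe, hZ, fourier_even hi hφ.2.2.1]
  have hgi : Integrable fun w => (g w : ℂ) :=
    ((𝓕 Z).integrable (μ := volume)).congr (ae_of_all _ hF)
  have hinv : ∀ u, (φ u : ℂ) =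
      ∫ w, Complex.exp (((2 * Real.pi * (w * u) : ℝ) : ℂ) * Complex.I) * (g w : ℂ) := by
    intro u
    have h : 𝓕⁻ (𝓕 Z) u = Z u := by rw [FourierTransform.fourierInv_fourier_eq]
    rw [SchwartzMap.fourierInv_coe, Real.fourierInv_eq', hZ] at h
    refine Eq.trans h.symm ?_
    congr 1
    ext w
    rw [hF, smul_eq_mul]
    simp [mul_comm w u]
  have hint : ∀ u, Integrable fun w =>
      Complex.exp (((2 * Real.pi * (w * u) : ℝ) : ℂ) * Complex.I) * (g w : ℂ) := by
    intro u
    refine hgi.bdd_mul (c := 1) (by fun_prop) (ae_of_all _ fun w => ?_)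
    rw [Complex.norm_exp_ofReal_mul_I]
  have hsum : ∑ j, ∑ k, (φ (x j - x k) : ℂ) * ρ j * (starRingEnd ℂ) (ρ k) =
      ((∫ w, g w * Complex.normSq (∑ j, ρ j *
        Complex.exp (((2 * Real.pi * (w * x j) : ℝ) : ℂ) * Complex.I)) : ℝ) : ℂ) := by
    rw [← integral_complex_ofReal]
    have e : ∀ w, ((g w * Complex.normSq (∑ j, ρ j *
        Complex.exp (((2 * Real.pi * (w * x j) : ℝ) : ℂ) * Complex.I)) : ℝ) : ℂ) =
        ∑ j, ∑ k, (Complex.exp (((2 * Real.pi * (w * (x j - x k)) : ℝ) : ℂ) * Complex.I) *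
          (g w : ℂ)) * (ρ j * (starRingEnd ℂ) (ρ k)) := by
      intro w
      rw [Complex.ofReal_mul, ← Complex.mul_conj, map_sum, Finset.sum_mul_sum, Finset.mul_sum]
      refine Finset.sum_congr rfl fun j _ => ?_
      rw [Finset.mul_sum]
      refine Finset.sum_congr rfl fun k _ => ?_
      rw [map_mul, ← Complex.exp_conj, map_mul, Complex.conj_ofReal, Complex.conj_I]
      have : (((2 * Real.pi * (w * (x j - x k)) : ℝ) : ℂ) * Complex.I) =
        (((2 * Real.pi * (w * x j) : ℝ) : ℂ) * Complex.I) +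
          (((2 * Real.pi * (w * x k) : ℝ) : ℂ) * -Complex.I) := by
        push_cast; ring
      rw [this, Complex.exp_add]
      ring
    simp_rw [e]
    rw [integral_finsetSum _ fun j _ => integrable_finsetSum _ fun k _ =>
      (hint _).mul_const _]
    refine Finset.sum_congr rfl fun j _ => ?_
    rw [integral_finsetSum _ fun k _ => (hint _).mul_const _]
    refine Finset.sum_congr rfl fun k _ => ?_
    rw [integral_mul_const, ← hinv, mul_assoc]
  rw [hsum, Complex.zero_le_real]
  exact integral_nonneg fun w => mul_nonneg (hf _) (Complex.normSq_nonneg _)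

/-- **Theorem 3.3 (Mathias).** Let `φ` be an admissible kernel and
`f(t) := ∫ φ(x)·cos(xt) dx`.  Then `φ` is positive definite if and only if
`f(t) ≥ 0` for every `t ∈ ℝ`. -/
theorem thm_3_3 (φ : ℝ → ℝ) (hφ : AdmissibleKernel φ) :
    PosDefKernel φ ↔ ∀ t : ℝ, 0 ≤ ∫ x : ℝ, φ x * Real.cos (x * t) := by
  refine ⟨fun h t => ?_, pd_of_nonneg hφ⟩
  obtain ⟨S, hS⟩ := exists_schwartz hφ
  have hi : Integrable φ := (S.integrable (μ := volume)).congr (ae_of_all _ hS)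
  obtain ⟨C, -, hC⟩ := S.decay 0 0
  have hcont := hφ.1.continuous
  refine pd_lebesgue (fun x => φ x * Real.cos (x * t)) (by fun_prop) C ?_ ?_ ?_
  · intro x
    have := hC x
    simp only [pow_zero, one_mul, norm_iteratedFDeriv_zero, hS] at this
    rw [norm_mul]
    exact (mul_le_of_le_one_right (norm_nonneg _) (Real.abs_cos_le_one _)).trans this
  · exact hi.mul_bdd (c := 1) (by fun_prop) (ae_of_all _ fun x => Real.abs_cos_le_one _)
  · exact fun T c => pd_finset h t T c
end

section
/- Let φ be an admissible kernel such that log φ is strictly concave on (0, ∞) (i.e. (d²/dt²) log φ(t) < 0 for all t > 0). Then for each n ∈ ℕ₀ the associated kernel Kₙ(t) := ∫_{−∞}^{∞} φ(s+t)·φ(s−t)·s^{2n} ds is also an admissible kernel; in particular Kₙ′(t) < 0 for all t > 0. -/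
/-- The associated kernel `Kₙ(t) := ∫ φ(s+t)·φ(s−t)·s^{2n} ds`. -/
noncomputable def assocKernel (φ : ℝ → ℝ) (n : ℕ) (t : ℝ) : ℝ :=
  ∫ s : ℝ, φ (s + t) * φ (s - t) * s ^ (2 * n)

open MeasureTheory Filter in
lemma aux_global (f : ℝ → ℝ) (hf : Continuous f) (p : ℝ) (hp : 2 < p)
    (h : f =O[Filter.cocompact ℝ] fun t => Real.exp (-|t| ^ p)) :
    ∃ C : ℝ, 0 ≤ C ∧ ∀ t, |f t| ≤ C * Real.exp (-|t| ^ p) := by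
  have hpc : Continuous fun t : ℝ => |t| ^ p :=
    continuous_abs.rpow_const (fun x => Or.inr (by linarith))
  obtain ⟨c, hc⟩ := h.bound
  obtain ⟨S, hS, hSc⟩ := Filter.mem_cocompact.1 hc
  obtain ⟨D, hD⟩ := hS.exists_bound_of_continuousOn
    (f := fun t => f t * Real.exp (|t| ^ p)) (by fun_prop)
  refine ⟨max (max c D) 0, le_max_right _ _, fun t => ?_⟩
  have he : 0 < Real.exp (-|t| ^ p) := Real.exp_pos _
  by_cases ht : t ∈ S
  · have h1 := hD t ht
    rw [Real.norm_eq_abs, abs_mul, Real.abs_exp] at h1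
    have h2 : |f t| = (|f t| * Real.exp (|t| ^ p)) * Real.exp (-|t| ^ p) := by
      rw [mul_assoc, ← Real.exp_add]; simp
    rw [h2]
    gcongr
    exact h1.trans ((le_max_right _ _).trans (le_max_left _ _))
  · have h1 : ‖f t‖ ≤ c * ‖Real.exp (-|t| ^ p)‖ := hSc ht
    rw [Real.norm_eq_abs, Real.norm_eq_abs, Real.abs_exp] at h1
    refine h1.trans ?_
    gcongr
    exact (le_max_left _ _).trans (le_max_left _ _)

lemma aux_int (n : ℕ) (p : ℝ) (hp : 2 < p) :
    MeasureTheory.Integrable fun s : ℝ => Real.exp (-|s| ^ p) * s ^ (2 * n) := by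
  have hpc : Continuous fun t : ℝ => |t| ^ p :=
    continuous_abs.rpow_const (fun x => Or.inr (by linarith))
  have h1 := integrable_rpow_mul_exp_neg_mul_sq (b := 1) one_pos (s := ((2 * n : ℕ) : ℝ))
    (by have : (0:ℝ) ≤ ((2 * n : ℕ) : ℝ) := Nat.cast_nonneg _
        linarith)
  refine (h1.const_mul (Real.exp 1)).mono' (by fun_prop) (Filter.Eventually.of_forall fun s => ?_)
  have hpos : 0 ≤ s ^ (2 * n) := by rw [pow_mul]; positivity
  rw [Real.norm_eq_abs, abs_mul, Real.abs_exp, abs_of_nonneg hpos, Real.rpow_natCast,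
    mul_left_comm, ← Real.exp_add, mul_comm]
  gcongr
  rcases le_total |s| 1 with h | h
  · have : 0 ≤ |s| ^ p := by positivity
    have : s ^ 2 ≤ 1 := by rw [← sq_abs]; nlinarith [abs_nonneg s]
    linarith
  · have : |s| ^ (2:ℝ) ≤ |s| ^ p := Real.rpow_le_rpow_of_exponent_le h hp.le
    rw [Real.rpow_two, sq_abs] at this
    linarith

lemma aux_super (p : ℝ) (hp : 2 < p) (s t : ℝ) :
    |s| ^ p + |t| ^ p ≤ |s + t| ^ p + |s - t| ^ p := by
  have h0 : |s| ^ p + |t| ^ p ≤ (|s| + |t|) ^ p := by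
    have := Real.add_rpow_le_rpow_add (abs_nonneg s) (abs_nonneg t) (show 1 ≤ p by linarith)
    exact this
  have h1 : 0 ≤ |s + t| ^ p := by positivity
  have h2 : 0 ≤ |s - t| ^ p := by positivity
  have h3 : |s| + |t| = |s + t| ∨ |s| + |t| = |s - t| := by
    rcases abs_cases s with h | h <;> rcases abs_cases t with hd2 | hd2 <;>
      rcases abs_cases (s + t) with hd3 | hd3 <;> rcases abs_cases (s - t) with hd4 | hd4 <;>
      first
      | (left; linarith)
      | (right; linarith)
  rcases h3 with h | h <;> rw [h] at h0 <;> linarith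

/-- Mixed kernel. -/
noncomputable def auxJ (φ : ℝ → ℝ) (n i j : ℕ) (t : ℝ) : ℝ :=
  ∫ s : ℝ, iteratedDeriv i φ (s + t) * iteratedDeriv j φ (s - t) * s ^ (2 * n)

section main
variable {φ : ℝ → ℝ} {p : ℝ}

lemma aux_bd (hp : 2 < p)
    (hb : ∀ i, ∃ C : ℝ, 0 ≤ C ∧ ∀ t, |iteratedDeriv i φ t| ≤ C * Real.exp (-|t| ^ p))
    (n i j : ℕ) : ∃ C : ℝ, 0 ≤ C ∧ ∀ s t,
      ‖iteratedDeriv i φ (s + t) * iteratedDeriv j φ (s - t) * s ^ (2 * n)‖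
        ≤ C * Real.exp (-|t| ^ p) * (Real.exp (-|s| ^ p) * s ^ (2 * n)) := by
  obtain ⟨C, hC, h1⟩ := hb i
  obtain ⟨D, hD, h2⟩ := hb j
  refine ⟨C * D, by positivity, fun s t => ?_⟩
  have hpos : 0 ≤ s ^ (2 * n) := by rw [pow_mul]; positivity
  rw [Real.norm_eq_abs, abs_mul, abs_mul, abs_of_nonneg hpos, ← mul_assoc]
  refine mul_le_mul_of_nonneg_right ?_ hpos
  calc _ ≤ (C * Real.exp (-|s + t| ^ p)) * (D * Real.exp (-|s - t| ^ p)) :=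
        mul_le_mul (h1 _) (h2 _) (abs_nonneg _) (by positivity)
    _ = C * D * Real.exp (-|s + t| ^ p + -|s - t| ^ p) := by rw [Real.exp_add]; ring
    _ ≤ C * D * Real.exp (-|t| ^ p + -|s| ^ p) := by
        gcongr C * D * Real.exp ?_
        linarith [aux_super p hp s t]
    _ = _ := by rw [Real.exp_add]; ring

lemma aux_cont (hφ : ContDiff ℝ (⊤ : ℕ∞) φ) (i : ℕ) : Continuous (iteratedDeriv i φ) :=
  hφ.continuous_iteratedDeriv i (by exact_mod_cast le_top)

lemma aux_hd (hφ : ContDiff ℝ (⊤ : ℕ∞) φ) (i : ℕ) (x : ℝ) :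
    HasDerivAt (iteratedDeriv i φ) (iteratedDeriv (i + 1) φ x) x := by
  rw [iteratedDeriv_succ]
  exact (hφ.differentiable_iteratedDeriv i
    (by exact_mod_cast WithTop.coe_lt_top i)).differentiableAt.hasDerivAt

lemma aux_integrable (hφ : ContDiff ℝ (⊤ : ℕ∞) φ) (hp : 2 < p)
    (hb : ∀ i, ∃ C : ℝ, 0 ≤ C ∧ ∀ t, |iteratedDeriv i φ t| ≤ C * Real.exp (-|t| ^ p))
    (n i j : ℕ) (t : ℝ) : MeasureTheory.Integrable fun s : ℝ =>
      iteratedDeriv i φ (s + t) * iteratedDeriv j φ (s - t) * s ^ (2 * n) := by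
  obtain ⟨C, hC, h⟩ := aux_bd hp hb n i j
  have h1 := aux_cont hφ i
  have h2 := aux_cont hφ j
  refine ((aux_int n p hp).const_mul (C * Real.exp (-|t| ^ p))).mono' ?_
    (Filter.Eventually.of_forall fun s => h s t)
  exact Continuous.aestronglyMeasurable (by fun_prop)

lemma aux_hasDeriv (hφ : ContDiff ℝ (⊤ : ℕ∞) φ) (hp : 2 < p)
    (hb : ∀ i, ∃ C : ℝ, 0 ≤ C ∧ ∀ t, |iteratedDeriv i φ t| ≤ C * Real.exp (-|t| ^ p))
    (n i j : ℕ) (t : ℝ) :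
    HasDerivAt (auxJ φ n i j) (auxJ φ n (i + 1) j t - auxJ φ n i (j + 1) t) t := by
  obtain ⟨C, hC, h⟩ := aux_bd hp hb n (i + 1) j
  obtain ⟨D, hD, hd2⟩ := aux_bd hp hb n i (j + 1)
  have key := hasDerivAt_integral_of_dominated_loc_of_deriv_le (μ := MeasureTheory.volume)
    (F := fun (t s : ℝ) => iteratedDeriv i φ (s + t) * iteratedDeriv j φ (s - t) * s ^ (2 * n))
    (F' := fun (t s : ℝ) =>
      iteratedDeriv (i + 1) φ (s + t) * iteratedDeriv j φ (s - t) * s ^ (2 * n) -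
      iteratedDeriv i φ (s + t) * iteratedDeriv (j + 1) φ (s - t) * s ^ (2 * n))
    (bound := fun s => (C + D) * (Real.exp (-|s| ^ p) * s ^ (2 * n)))
    (x₀ := t) (s := Set.univ) Filter.univ_mem
    (Filter.Eventually.of_forall fun t => (aux_integrable hφ hp hb n i j t).aestronglyMeasurable)
    (aux_integrable hφ hp hb n i j t)
    ((aux_integrable hφ hp hb n (i + 1) j t).sub
      (aux_integrable hφ hp hb n i (j + 1) t)).aestronglyMeasurable
    (Filter.Eventually.of_forall fun s t _ => ?_)
    ((aux_int n p hp).const_mul _)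
    (Filter.Eventually.of_forall fun s t _ => ?_)
  · have h2 := key.2
    rw [MeasureTheory.integral_sub (aux_integrable hφ hp hb n (i + 1) j t)
      (aux_integrable hφ hp hb n i (j + 1) t)] at h2
    exact h2
  · refine (norm_sub_le _ _).trans ((add_le_add (h s t) (hd2 s t)).trans ?_)
    have hpos : 0 ≤ s ^ (2 * n) := by rw [pow_mul]; positivity
    have hE : Real.exp (-|t| ^ p) ≤ 1 := by
      rw [Real.exp_le_one_iff]
      have : 0 ≤ |t| ^ p := by positivity
      linarith
    rw [← add_mul, ← add_mul]
    refine mul_le_mul_of_nonneg_right ?_ (by positivity)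
    exact mul_le_of_le_one_right (by positivity) hE
  · have e1 : HasDerivAt (fun t => iteratedDeriv i φ (s + t))
        (iteratedDeriv (i + 1) φ (s + t)) t := by
      exact (aux_hd hφ i (s + t)).comp_const_add s t
    have e2 : HasDerivAt (fun t => iteratedDeriv j φ (s - t))
        (-iteratedDeriv (j + 1) φ (s - t)) t := by
      exact (aux_hd hφ j (s - t)).comp_const_sub s t
    refine ((e1.mul e2).mul_const (s ^ (2 * n))).congr_deriv ?_
    ring

lemma aux_deriv (hφ : ContDiff ℝ (⊤ : ℕ∞) φ) (hp : 2 < p)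
    (hb : ∀ i, ∃ C : ℝ, 0 ≤ C ∧ ∀ t, |iteratedDeriv i φ t| ≤ C * Real.exp (-|t| ^ p))
    (n i j : ℕ) :
    deriv (auxJ φ n i j) = auxJ φ n (i + 1) j - auxJ φ n i (j + 1) :=
  funext fun t => (aux_hasDeriv hφ hp hb n i j t).deriv

lemma aux_contDiff (hφ : ContDiff ℝ (⊤ : ℕ∞) φ) (hp : 2 < p)
    (hb : ∀ i, ∃ C : ℝ, 0 ≤ C ∧ ∀ t, |iteratedDeriv i φ t| ≤ C * Real.exp (-|t| ^ p))
    (n k : ℕ) : ∀ i j : ℕ, ContDiff ℝ k (auxJ φ n i j) := by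
  induction k with
  | zero =>
    intro i j
    have : Differentiable ℝ (auxJ φ n i j) :=
      fun t => (aux_hasDeriv hφ hp hb n i j t).differentiableAt
    exact contDiff_zero.2 this.continuous
  | succ k ih =>
    intro i j
    push_cast
    rw [contDiff_succ_iff_deriv]
    refine ⟨fun t => (aux_hasDeriv hφ hp hb n i j t).differentiableAt, by simp, ?_⟩
    rw [aux_deriv hφ hp hb]
    exact (ih _ _).sub (ih _ _)

lemma aux_decay (hφ : ContDiff ℝ (⊤ : ℕ∞) φ) (hp : 2 < p)
    (hb : ∀ i, ∃ C : ℝ, 0 ≤ C ∧ ∀ t, |iteratedDeriv i φ t| ≤ C * Real.exp (-|t| ^ p))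
    (n k : ℕ) : ∀ i j : ℕ, iteratedDeriv k (auxJ φ n i j)
      =O[Filter.cocompact ℝ] fun t => Real.exp (-|t| ^ p) := by
  induction k with
  | zero =>
    intro i j
    obtain ⟨C, hC, h⟩ := aux_bd hp hb n i j
    refine Asymptotics.IsBigO.of_bound (C * ∫ s : ℝ, Real.exp (-|s| ^ p) * s ^ (2 * n))
      (Filter.Eventually.of_forall fun t => ?_)
    rw [iteratedDeriv_zero]
    refine (MeasureTheory.norm_integral_le_of_norm_le
      ((aux_int n p hp).const_mul (C * Real.exp (-|t| ^ p)))
      (Filter.Eventually.of_forall fun s => h s t)).trans (le_of_eq ?_)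
    rw [MeasureTheory.integral_const_mul, Real.norm_eq_abs, Real.abs_exp]
    ring
  | succ k ih =>
    intro i j
    rw [iteratedDeriv_succ', aux_deriv hφ hp hb]
    have : iteratedDeriv k (auxJ φ n (i + 1) j - auxJ φ n i (j + 1)) =
        fun t => iteratedDeriv k (auxJ φ n (i + 1) j) t - iteratedDeriv k (auxJ φ n i (j + 1)) t := by
      funext t
      exact iteratedDeriv_sub (aux_contDiff hφ hp hb n k _ _).contDiffAt
        (aux_contDiff hφ hp hb n k _ _).contDiffAt
    rw [this]
    exact (ih _ _).sub (ih _ _)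

end main

lemma aux_anti (φ : ℝ → ℝ) (hs : ContDiff ℝ (⊤ : ℕ∞) φ) (hpos : ∀ t, 0 < φ t)
    (heven : ∀ t, φ (-t) = φ t)
    (hconc : ∀ t : ℝ, 0 < t → iteratedDeriv 2 (fun u => Real.log (φ u)) t < 0) :
    StrictAnti fun t => deriv φ t / φ t := by
  have hd : Differentiable ℝ φ := hs.differentiable (by simp)
  have hder : deriv (fun u => Real.log (φ u)) = fun t => deriv φ t / φ t :=
    funext fun t => deriv.log (hd t) (hpos t).ne'
  have hc : Continuous fun t => deriv φ t / φ t :=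
    (hs.continuous_deriv (by simp)).div hd.continuous fun t => (hpos t).ne'
  have hodd : ∀ t, deriv φ (-t) = - deriv φ t := by
    intro t
    have h1 : (fun x => φ (-x)) = φ := funext heven
    have h2 := deriv_comp_neg φ t
    rw [h1] at h2
    linarith
  have h1 : StrictAntiOn (fun t => deriv φ t / φ t) (Set.Ici 0) := by
    refine strictAntiOn_of_deriv_neg (convex_Ici 0) hc.continuousOn fun t ht => ?_
    rw [interior_Ici] at ht
    have := hconc t ht
    rwa [iteratedDeriv_succ, iteratedDeriv_one, hder] at this
  have h2 : StrictAntiOn (fun t => deriv φ t / φ t) (Set.Iic 0) := by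
    intro a ha b hb hab
    have := h1 (a := -b) (b := -a) (by simpa using hb) (by simpa using ha) (by linarith)
    simp only [hodd, heven, neg_div] at this
    simp only
    linarith
  exact StrictAntiOn.Iic_union_Ici h2 h1

/-- **Theorem 3.5.** Let `φ` be an admissible kernel with `log φ` strictly concave on
`(0, ∞)`.  Then for each `n ∈ ℕ₀` the associated kernel
`Kₙ(t) = ∫ φ(s+t)·φ(s−t)·s^{2n} ds` is also an admissible kernel; in particular
`Kₙ′(t) < 0` for all `t > 0`. -/
theorem thm_3_5 (φ : ℝ → ℝ) (hφ : AdmissibleKernel φ)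
    (hconc : ∀ t : ℝ, 0 < t → iteratedDeriv 2 (fun u => Real.log (φ u)) t < 0) :
    ∀ n : ℕ, AdmissibleKernel (assocKernel φ n) ∧
      ∀ t : ℝ, 0 < t → deriv (assocKernel φ n) t < 0 := by
  intro n
  obtain ⟨hs, hpos, heven, -, ε, hε, hdec⟩ := hφ
  have hp : 2 < 2 + ε := by linarith
  have hb := fun i => aux_global _ (aux_cont hs i) (2 + ε) hp (hdec i)
  have hJ : assocKernel φ n = auxJ φ n 0 0 := by
    funext t
    simp only [assocKernel, auxJ, iteratedDeriv_zero]
  have hanti := aux_anti φ hs hpos heven hconc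
  have hdn : ∀ t : ℝ, 0 < t → deriv (assocKernel φ n) t < 0 := by
    intro t ht
    rw [hJ, aux_deriv hs hp hb]
    simp only [Pi.sub_apply, auxJ, zero_add]
    have i1 := aux_integrable hs hp hb n 0 1 t
    have i2 := aux_integrable hs hp hb n 1 0 t
    rw [sub_neg, ← sub_pos, ← MeasureTheory.integral_sub i1 i2]
    have c0 := aux_cont hs 0
    have c1 := aux_cont hs 1
    have key : ∀ s, 0 < iteratedDeriv 0 φ (s + t) * iteratedDeriv 1 φ (s - t)
        - iteratedDeriv 1 φ (s + t) * iteratedDeriv 0 φ (s - t) := by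
      intro s
      have h := hanti (show s - t < s + t by linarith)
      simp only at h
      rw [div_lt_div_iff₀ (hpos _) (hpos _)] at h
      rw [iteratedDeriv_zero, iteratedDeriv_one]
      linarith
    refine MeasureTheory.integral_pos_of_integrable_nonneg_nonzero (x := 1) (by fun_prop) (i1.sub i2) ?_ ?_
    · intro s
      have hq : 0 ≤ s ^ (2 * n) := by rw [pow_mul]; positivity
      have := mul_nonneg (key s).le hq
      simp only [Pi.zero_apply]
      linarith
    · have := key 1
      simp only [one_pow, mul_one]
      exact this.ne'
  refine ⟨⟨?_, ?_, ?_, hdn, ε, hε, ?_⟩, hdn⟩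
  · rw [hJ]
    exact contDiff_infty.2 fun k => aux_contDiff hs hp hb n k 0 0
  · intro t
    have i0 := aux_integrable hs hp hb n 0 0 t
    have c0 := aux_cont hs 0
    simp only [iteratedDeriv_zero] at i0 c0
    refine MeasureTheory.integral_pos_of_integrable_nonneg_nonzero (x := 1) (by fun_prop) i0 ?_ ?_
    · intro s
      have hq : 0 ≤ s ^ (2 * n) := by rw [pow_mul]; positivity
      exact mul_nonneg (mul_pos (hpos _) (hpos _)).le hq
    · simp only [one_pow, mul_one]
      exact (mul_pos (hpos _) (hpos _)).ne'
  · intro t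
    unfold assocKernel
    congr 1
    funext s
    rw [sub_neg_eq_add, ← sub_eq_add_neg, mul_comm (φ (s - t))]
  · rw [hJ]
    exact fun k => aux_decay hs hp hb n k 0 0
end

section
/- Define K_Φ(t) := ∫_{t}^{∞} Φ(√u) du for t ≥ 0. Then log K_Φ(t) is strictly concave for t > 0; that is, (d²/dt²) log K_Φ(t) < 0 for all t > 0. -/
/-- The Jacobi theta kernel `Φ(t) := ∑_{n=1}^∞ π n² (2π n² e^{4t} − 3)·exp(5t − π n² e^{4t})`. -/
noncomputable def jacobiPhi (t : ℝ) : ℝ :=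
  ∑' n : ℕ, Real.pi * ((n : ℝ) + 1) ^ 2 *
    (2 * Real.pi * ((n : ℝ) + 1) ^ 2 * Real.exp (4 * t) - 3) *
    Real.exp (5 * t - Real.pi * ((n : ℝ) + 1) ^ 2 * Real.exp (4 * t))

/-- `K_Φ(t) := ∫_t^∞ Φ(√u) du`. -/
noncomputable def KPhi (t : ℝ) : ℝ := ∫ u in Set.Ioi t, jacobiPhi (Real.sqrt u)

open Polynomial Filter Topology Set

namespace JPhi

/-- the variable `y = π n² e^{4v}` -/
noncomputable def yy (n : ℕ) (v : ℝ) : ℝ := Real.pi * ((n : ℝ) + 1) ^ 2 * Real.exp (4 * v)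

/-- general term -/
noncomputable def hh (P : ℝ[X]) (n : ℕ) (v : ℝ) : ℝ := P.eval (yy n v) * Real.exp (v - yy n v)

/-- the polynomial of the derivative -/
noncomputable def DD (P : ℝ[X]) : ℝ[X] := P + 4 * X * (derivative P - P)

lemma yy_pos (n : ℕ) (v : ℝ) : 0 < yy n v := by
  unfold yy; have := Real.pi_pos; positivity

lemma hasDerivAt_yy (n : ℕ) (v : ℝ) : HasDerivAt (yy n) (4 * yy n v) v := by
  unfold yy
  have h := (((hasDerivAt_id v).const_mul (4 : ℝ)).exp).const_mul (Real.pi * ((n : ℝ) + 1) ^ 2)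
  refine h.congr_deriv ?_
  simp only [id]; ring

lemma hasDerivAt_hh (P : ℝ[X]) (n : ℕ) (v : ℝ) : HasDerivAt (hh P n) (hh (DD P) n v) v := by
  unfold hh
  have h1 := (P.hasDerivAt (yy n v)).comp v (hasDerivAt_yy n v)
  have h2 := ((hasDerivAt_id v).sub (hasDerivAt_yy n v)).exp
  refine (h1.mul h2).congr_deriv ?_
  simp [DD]; ring

lemma poly_bound (P : ℝ[X]) : ∃ C : ℝ, 0 ≤ C ∧ ∀ y : ℝ, 0 ≤ y → |P.eval y| * Real.exp (-y) ≤ C := by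
  induction P using Polynomial.induction_on' with
  | add p q hp hq =>
    obtain ⟨C, hC, h⟩ := hp
    obtain ⟨D, hD, h'⟩ := hq
    refine ⟨C + D, by positivity, fun y hy => ?_⟩
    have := abs_add_le (p.eval y) (q.eval y)
    have he := Real.exp_pos (-y)
    rw [eval_add]
    nlinarith [h y hy, h' y hy]
  | monomial k a =>
    refine ⟨|a| * k.factorial, by positivity, fun y hy => ?_⟩
    rw [eval_monomial, abs_mul, abs_of_nonneg (pow_nonneg hy k), Real.exp_neg]
    have := Real.pow_div_factorial_le_exp y hy k
    have hk : (0 : ℝ) < k.factorial := by positivity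
    have he := Real.exp_pos y
    rw [div_le_iff₀ hk] at this
    rw [mul_assoc]
    apply mul_le_mul_of_nonneg_left _ (abs_nonneg a)
    rw [← div_eq_mul_inv, div_le_iff₀ he]
    linarith

lemma hh_bound (P : ℝ[X]) : ∃ C : ℝ, ∀ (n : ℕ) (v : ℝ), -1 < v → ‖hh P n v‖ ≤ C * (1 / ((n : ℝ) + 1) ^ 2) := by
  obtain ⟨C, hC, h⟩ := poly_bound (X ^ 2 * P)
  refine ⟨C * (Real.exp 3 * Real.exp 4), fun n v hv => ?_⟩
  have h1 := h (yy n v) (yy_pos n v).le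
  have hy := yy_pos n v
  have hN : (1 : ℝ) ≤ ((n : ℝ) + 1) ^ 2 := by
    have : (0 : ℝ) ≤ n := by positivity
    nlinarith
  have hpi := Real.pi_gt_three
  have e1 : Real.exp v ≤ Real.exp 3 * yy n v := by
    have a1 : Real.exp v ≤ Real.exp 3 * Real.exp (4 * v) := by
      rw [← Real.exp_add]; apply Real.exp_le_exp.2; linarith
    have a2 : Real.exp (4 * v) ≤ yy n v := by
      unfold yy
      have : 1 ≤ Real.pi * ((n : ℝ) + 1) ^ 2 := by nlinarith
      nlinarith [Real.exp_pos (4 * v)]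
    nlinarith [Real.exp_pos 3]
  have e2 : ((n : ℝ) + 1) ^ 2 ≤ Real.exp 4 * yy n v := by
    have a1 : 1 ≤ Real.exp 4 * Real.exp (4 * v) := by
      rw [← Real.exp_add]; apply Real.one_le_exp; linarith
    unfold yy
    have : Real.exp 4 * (Real.pi * ((n : ℝ) + 1) ^ 2 * Real.exp (4 * v)) =
      (Real.exp 4 * Real.exp (4 * v)) * Real.pi * ((n : ℝ) + 1) ^ 2 := by ring
    rw [this]
    have : 1 ≤ (Real.exp 4 * Real.exp (4 * v)) * Real.pi := by nlinarith
    nlinarith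
  rw [mul_one_div, le_div_iff₀ (by positivity)]
  have : ‖hh P n v‖ = |P.eval (yy n v)| * Real.exp (-yy n v) * Real.exp v := by
    unfold hh
    rw [Real.norm_eq_abs, abs_mul, abs_of_pos (Real.exp_pos _), sub_eq_neg_add, Real.exp_add]; ring
  rw [this]
  simp only [eval_mul, eval_pow, eval_X, abs_mul, abs_of_pos hy, abs_pow] at h1
  set A := |P.eval (yy n v)| * Real.exp (-yy n v) with hA
  have hA0 : 0 ≤ A := by positivity
  calc A * Real.exp v * ((n : ℝ) + 1) ^ 2 ≤ A * (Real.exp 3 * yy n v) * (Real.exp 4 * yy n v) := by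
        gcongr
    _ = (yy n v ^ 2 * |P.eval (yy n v)| * Real.exp (-yy n v)) * (Real.exp 3 * Real.exp 4) := by
        rw [hA]; ring
    _ ≤ _ := by gcongr

lemma summable_sq (C : ℝ) : Summable (fun n : ℕ => C * (1 / ((n : ℝ) + 1) ^ 2)) := by
  apply Summable.mul_left
  have := (summable_nat_add_iff 1).2 (Real.summable_one_div_nat_pow.2 (le_refl 2))
  simpa using this

lemma summable_hh (P : ℝ[X]) {v : ℝ} (hv : -1 < v) : Summable (fun n => hh P n v) := by
  obtain ⟨C, hC⟩ := hh_bound P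
  exact Summable.of_norm_bounded (summable_sq C) (fun n => hC n v hv)

/-- the sum -/
noncomputable def SS (P : ℝ[X]) (v : ℝ) : ℝ := ∑' n, hh P n v

lemma hasDerivAt_SS (P : ℝ[X]) {v : ℝ} (hv : -1 < v) : HasDerivAt (SS P) (SS (DD P) v) v := by
  obtain ⟨C, hC⟩ := hh_bound (DD P)
  exact hasDerivAt_tsum_of_isPreconnected (summable_sq C) (isOpen_Ioi (a := (-1 : ℝ)))
    isPreconnected_Ioi (fun n y _ => hasDerivAt_hh P n y) (fun n y hy => hC n y hy) hv
    (summable_hh P hv) hv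

/-- main polynomial -/
noncomputable def PP : ℝ[X] := 2 * X ^ 2 - 3 * X

lemma jacobi_eq (v : ℝ) : jacobiPhi v = SS PP v := by
  unfold jacobiPhi SS
  congr 1; ext n
  unfold hh
  have : Real.exp (5 * v - Real.pi * ((n : ℝ) + 1) ^ 2 * Real.exp (4 * v)) =
     Real.exp (4 * v) * Real.exp (v - yy n v) := by
    rw [← Real.exp_add]; congr 1; unfold yy; ring
  rw [this]
  simp [PP, yy]; ring

lemma SS_one_symm (v : ℝ) (h1 : -1 < v) (h2 : v < 1) :
    SS 1 (-v) = SS 1 v + (Real.exp v - Real.exp (-v)) / 2 := by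
  have key : ∀ w : ℝ, -1 < w → Real.exp w * ∑' n : ℤ, Real.exp (-Real.pi * Real.exp (4 * w) * (n : ℝ) ^ 2)
      = Real.exp w + 2 * SS 1 w := by
    intro w hw
    have hs := summable_hh 1 hw
    have hs' : Summable (fun n : ℕ => Real.exp (-Real.pi * Real.exp (4 * w) * ((n : ℝ) + 1) ^ 2)) := by
      have := hs.mul_left (Real.exp (-w))
      refine this.congr fun n => ?_
      simp only [hh, eval_one, one_mul]
      rw [← Real.exp_add]; congr 1; unfold yy; ring
    have e : ∑' n : ℤ, Real.exp (-Real.pi * Real.exp (4 * w) * (n : ℝ) ^ 2) =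
        1 + 2 * ∑' n : ℕ, Real.exp (-Real.pi * Real.exp (4 * w) * ((n : ℝ) + 1) ^ 2) := by
      have h0 : HasSum (fun n : ℕ => Real.exp (-Real.pi * Real.exp (4 * w) * (((n : ℤ) : ℝ)) ^ 2))
          (1 + ∑' n : ℕ, Real.exp (-Real.pi * Real.exp (4 * w) * ((n : ℝ) + 1) ^ 2)) := by
        have := (hasSum_nat_add_iff (f := fun n : ℕ =>
          Real.exp (-Real.pi * Real.exp (4 * w) * (((n : ℤ) : ℝ)) ^ 2)) 1).1 (by simpa using hs'.hasSum)
        rw [add_comm]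
        simpa using this
      have h3 : HasSum (fun n : ℕ => Real.exp (-Real.pi * Real.exp (4 * w) * (((-(n + 1 : ℤ)) : ℤ) : ℝ) ^ 2))
          (∑' n : ℕ, Real.exp (-Real.pi * Real.exp (4 * w) * ((n : ℝ) + 1) ^ 2)) := by
        convert hs'.hasSum using 3 with n
        push_cast; ring
      have := HasSum.of_nat_of_neg_add_one (f := fun n : ℤ => Real.exp (-Real.pi * Real.exp (4 * w) * (n : ℝ) ^ 2)) h0 h3
      rw [this.tsum_eq]; ring
    rw [e]
    have : SS 1 w = Real.exp w * ∑' n : ℕ, Real.exp (-Real.pi * Real.exp (4 * w) * ((n : ℝ) + 1) ^ 2) := by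
      rw [← tsum_mul_left]
      unfold SS
      congr 1; ext n
      simp only [hh, eval_one, one_mul]
      rw [← Real.exp_add]; congr 1; unfold yy; ring
    rw [this]; ring
  have k1 := key v h1
  have k2 := key (-v) (by linarith)
  have th := Real.tsum_exp_neg_mul_int_sq (Real.exp_pos (4 * v))
  have e1 : (Real.exp (4 * v)) ^ (1 / 2 : ℝ) = Real.exp (2 * v) := by
    rw [← Real.exp_mul]; congr 1; ring
  have e2 : ∀ n : ℤ, -Real.pi / Real.exp (4 * v) * (n : ℝ) ^ 2 = -Real.pi * Real.exp (4 * -v) * (n : ℝ) ^ 2 := by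
    intro n
    rw [mul_neg, Real.exp_neg]; ring
  simp only [e2] at th
  rw [e1] at th
  rw [th, one_div, ← Real.exp_neg, ← mul_assoc, ← Real.exp_add] at k1
  have : v + -(2 * v) = -v := by ring
  rw [this, k2] at k1
  linarith

lemma DD2 : DD (DD 1) = 1 + 8 * PP := by
  simp [DD, PP]; ring

lemma SS_even (v : ℝ) (h1 : -1 < v) (h2 : v < 1) : SS PP (-v) = SS PP v := by
  have s1 : ∀ v : ℝ, -1 < v → v < 1 → SS (DD 1) (-v) = -SS (DD 1) v - (Real.exp v + Real.exp (-v)) / 2 := by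
    intro v h1 h2
    have a := (hasDerivAt_SS 1 (v := -v) (by linarith)).comp v (hasDerivAt_neg v)
    have b := (hasDerivAt_SS 1 h1).add (((Real.hasDerivAt_exp v).sub ((hasDerivAt_neg v).exp)).div_const 2)
    have : (SS 1 ∘ Neg.neg) =ᶠ[𝓝 v] (SS 1 + fun v => (Real.exp v - Real.exp (-v)) / 2) := by
      filter_upwards [Ioo_mem_nhds h1 h2] with w hw
      exact SS_one_symm w hw.1 hw.2
    have := (b.congr_of_eventuallyEq this).unique a
    linarith
  have s2 : SS (DD (DD 1)) (-v) = SS (DD (DD 1)) v + (Real.exp v - Real.exp (-v)) / 2 := by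
    have a := (hasDerivAt_SS (DD 1) (v := -v) (by linarith)).comp v (hasDerivAt_neg v)
    have b := (hasDerivAt_SS (DD 1) h1).neg.sub (((Real.hasDerivAt_exp v).add ((hasDerivAt_neg v).exp)).div_const 2)
    have : (SS (DD 1) ∘ Neg.neg) =ᶠ[𝓝 v] (-SS (DD 1) - fun v => (Real.exp v + Real.exp (-v)) / 2) := by
      filter_upwards [Ioo_mem_nhds h1 h2] with w hw
      exact s1 w hw.1 hw.2
    have := (b.congr_of_eventuallyEq this).unique a
    linarith
  have s3 : ∀ w : ℝ, -1 < w → SS (DD (DD 1)) w = SS 1 w + 8 * SS PP w := by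
    intro w hw
    unfold SS
    rw [← tsum_mul_left, ← (summable_hh 1 hw).tsum_add ((summable_hh PP hw).mul_left 8)]
    congr 1; ext n
    rw [DD2]
    simp [hh]; ring
  have := SS_one_symm v h1 h2
  rw [s3 v h1, s3 (-v) (by linarith)] at s2
  linarith

lemma SS_deriv_zero : SS (DD PP) 0 = 0 := by
  have a := (hasDerivAt_SS PP (v := -0) (by norm_num)).comp (0 : ℝ) (hasDerivAt_neg (0 : ℝ))
  have b := hasDerivAt_SS PP (v := 0) (by norm_num)
  have : (SS PP ∘ Neg.neg) =ᶠ[𝓝 0] SS PP := by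
    filter_upwards [Ioo_mem_nhds (show (-1 : ℝ) < 0 by norm_num) (show (0 : ℝ) < 1 by norm_num)] with w hw
    exact SS_even w hw.1 hw.2
  have := (b.congr_of_eventuallyEq this).unique a
  rw [neg_zero] at this
  linarith

/-- minus the logarithmic derivative of the leading term -/
noncomputable def ell (y : ℝ) : ℝ := 4 * y - 9 - 12 / (2 * y - 3)

lemma ell_mono {a b : ℝ} (ha : 3 / 2 < a) (hab : a ≤ b) : ell a ≤ ell b := by
  unfold ell
  have : 12 / (2 * b - 3) ≤ 12 / (2 * a - 3) := by
    apply div_le_div_of_nonneg_left <;> linarith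
  linarith

lemma hhP (n : ℕ) (v : ℝ) :
    hh PP n v = yy n v * (2 * yy n v - 3) * Real.exp (v - yy n v) := by
  simp [hh, PP]; ring

lemma DDP : DD PP = -15 * X + 30 * X ^ 2 - 8 * X ^ 3 := by
  simp [DD, PP]; ring

lemma hhD (n : ℕ) (v : ℝ) :
    hh (DD PP) n v = -(yy n v * (8 * yy n v ^ 2 - 30 * yy n v + 15)) * Real.exp (v - yy n v) := by
  rw [DDP]; simp [hh]; ring

lemma hhDD (n : ℕ) (v : ℝ) :
    hh (DD (DD PP)) n v = (yy n v * (-75 + 330 * yy n v - 224 * yy n v ^ 2 + 32 * yy n v ^ 3))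
      * Real.exp (v - yy n v) := by
  rw [DDP]; simp [hh, DD]; ring

lemma pi_lo : (3.14159 : ℝ) < Real.pi := by have := Real.pi_gt_d6; linarith
lemma pi_hi : Real.pi < (3.1416 : ℝ) := Real.pi_lt_d4

lemma yy_zero (v : ℝ) : yy 0 v = Real.pi * Real.exp (4 * v) := by simp [yy]

lemma yy_ge (n : ℕ) {v : ℝ} (hv : 0 ≤ v) : yy 0 v ≤ yy n v ∧ Real.pi ≤ yy 0 v := by
  have hp := Real.pi_pos
  have he : 1 ≤ Real.exp (4 * v) := Real.one_le_exp (by linarith)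
  have hn : (0 : ℝ) ≤ n := by positivity
  refine ⟨?_, ?_⟩
  · rw [yy_zero]
    unfold yy
    have : Real.pi * 1 ≤ Real.pi * ((n : ℝ) + 1) ^ 2 := by
      apply mul_le_mul_of_nonneg_left _ hp.le
      nlinarith
    nlinarith
  · rw [yy_zero]; nlinarith

lemma yy_gt (n : ℕ) {v : ℝ} (hv : 0 ≤ v) : 3.14159 < yy n v := by
  have := yy_ge n hv
  linarith [pi_lo]

lemma hhP_pos (n : ℕ) {v : ℝ} (hv : 0 ≤ v) : 0 < hh PP n v := by
  rw [hhP]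
  have := yy_gt n hv
  have h1 : 0 < yy n v := by linarith
  have h2 : 0 < 2 * yy n v - 3 := by linarith
  positivity

lemma hhD_ell (n : ℕ) {v : ℝ} (hv : 0 ≤ v) : hh (DD PP) n v = -ell (yy n v) * hh PP n v := by
  rw [hhP, hhD]
  have := yy_gt n hv
  have h2 : 2 * yy n v - 3 ≠ 0 := by intro h; linarith
  unfold ell
  have e : 12 / (2 * yy n v - 3) * (2 * yy n v - 3) = 12 := div_mul_cancel₀ _ h2
  linear_combination (-(yy n v) * Real.exp (v - yy n v)) * e

lemma SS_pos {v : ℝ} (hv : 0 ≤ v) : 0 < SS PP v :=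
  (summable_hh PP (by linarith)).tsum_pos (fun n => (hhP_pos n hv).le) 0 (hhP_pos 0 hv)

lemma hh0_le_SS {v : ℝ} (hv : 0 ≤ v) : hh PP 0 v ≤ SS PP v :=
  (summable_hh PP (by linarith)).le_tsum 0 (fun n _ => (hhP_pos n hv).le)

lemma low {v : ℝ} (hv : 0 ≤ v) : SS (DD PP) v ≤ -ell (yy 0 v) * SS PP v := by
  unfold SS
  rw [← tsum_mul_left]
  refine (summable_hh (DD PP) (by linarith)).tsum_le_tsum (fun n => ?_)
    ((summable_hh PP (by linarith)).mul_left _)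
  rw [hhD_ell n hv]
  have h := ell_mono (by linarith [yy_gt 0 hv]) (yy_ge n hv).1
  have := hhP_pos n hv
  nlinarith

lemma tail_term (n : ℕ) {v : ℝ} (hv : 0 ≤ v) :
    -hh (DD PP) (n + 1) v * hh PP 0 0 ≤ -hh (DD PP) (n + 1) 0 * hh PP 0 v := by
  rw [hhD, hhD, hhP, hhP]
  have e0 : yy 0 0 = Real.pi := by simp [yy]
  obtain ⟨N, hN⟩ : ∃ N : ℝ, N = (((n + 1 : ℕ) : ℝ) + 1) ^ 2 := ⟨_, rfl⟩
  have hN4 : 4 ≤ N := by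
    rw [hN]; push_cast
    have : (0 : ℝ) ≤ n := by positivity
    nlinarith
  have e1 : yy (n + 1) 0 = N * Real.pi := by simp [yy, hN]; ring
  have e2 : yy (n + 1) v = N * yy 0 v := by simp [yy, hN]; ring
  have hy := (yy_ge 0 hv).2
  rw [e0, e1, e2]
  obtain ⟨y, hyd⟩ : ∃ y, y = yy 0 v := ⟨_, rfl⟩
  rw [← hyd] at hy ⊢
  have p1 := pi_lo
  obtain ⟨p, hp⟩ : ∃ p, p = Real.pi := ⟨_, rfl⟩
  rw [← hp] at hy p1 ⊢
  obtain ⟨d, hd⟩ : ∃ d, d = y - p := ⟨_, rfl⟩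
  have hd0 : 0 ≤ d := by linarith
  have hexp : 1 + 3 * d + (3 * d) ^ 2 / 2 ≤ Real.exp ((N - 1) * d) := by
    refine (Real.quadratic_le_exp_of_nonneg (by positivity)).trans ?_
    apply Real.exp_le_exp.2; nlinarith
  have E : Real.exp (0 - N * p) * Real.exp (v - y) =
      Real.exp ((N - 1) * d) * (Real.exp (v - N * y) * Real.exp (0 - p)) := by
    rw [← Real.exp_add, ← Real.exp_add, ← Real.exp_add]; congr 1; rw [hd]; ring
  have z0 : 12 ≤ N * p := by nlinarith
  have q0 : 0 < 8 * (N * p) ^ 2 - 30 * (N * p) + 15 := by nlinarith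
  have key : 8 * (N * y) ^ 2 - 30 * (N * y) + 15 ≤
      (8 * (N * p) ^ 2 - 30 * (N * p) + 15) * Real.exp ((N - 1) * d) := by
    refine le_trans ?_ (mul_le_mul_of_nonneg_left hexp q0.le)
    have : y = p + d := by linarith
    rw [this]
    obtain ⟨z, hz⟩ : ∃ z, z = N * p := ⟨_, rfl⟩
    have hNz : N ≤ z / 3 := by rw [hz]; nlinarith
    have e : N * (p + d) = z + N * d := by rw [hz]; ring
    rw [e, ← hz]
    rw [← hz] at z0
    have c1 : 0 ≤ 3 * (8 * z ^ 2 - 30 * z + 15) - (16 * z - 30) * N := by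
      have : (16 * z - 30) * N ≤ (16 * z - 30) * (z / 3) :=
        mul_le_mul_of_nonneg_left hNz (by linarith)
      nlinarith
    have c2 : 0 ≤ (9 / 2) * (8 * z ^ 2 - 30 * z + 15) - 8 * N ^ 2 := by
      have : N ^ 2 ≤ (z / 3) ^ 2 := pow_le_pow_left₀ (by linarith) hNz 2
      nlinarith
    have := mul_nonneg c1 hd0
    have := mul_nonneg c2 (sq_nonneg d)
    nlinarith
  have key2 : (8 * (N * y) ^ 2 - 30 * (N * y) + 15) * (2 * p - 3) ≤
      (8 * (N * p) ^ 2 - 30 * (N * p) + 15) * Real.exp ((N - 1) * d) * (2 * y - 3) := by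
    apply mul_le_mul key (by linarith) (by linarith) (by positivity)
  have hpos : 0 ≤ N * p * y * (Real.exp (v - N * y) * Real.exp (0 - p)) := by
    have : 0 < p := by linarith
    have : 0 < y := by linarith
    positivity
  have := mul_le_mul_of_nonneg_left key2 hpos
  calc _ = N * p * y * (Real.exp (v - N * y) * Real.exp (0 - p)) *
      ((8 * (N * y) ^ 2 - 30 * (N * y) + 15) * (2 * p - 3)) := by ring
    _ ≤ _ := this
    _ = N * p * y * (8 * (N * p) ^ 2 - 30 * (N * p) + 15) * (2 * y - 3) *
        (Real.exp ((N - 1) * d) * (Real.exp (v - N * y) * Real.exp (0 - p))) := by ring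
    _ = _ := by rw [← E]; ring

lemma ell_pi : -(9 / 100) < ell Real.pi := by
  have h := ell_mono (by norm_num) pi_lo.le
  refine lt_of_lt_of_le ?_ h
  unfold ell; norm_num

lemma up_tail {v : ℝ} (hv : 0 ≤ v) : -SS (DD PP) v ≤ (ell (yy 0 v) + 9 / 100) * hh PP 0 v := by
  have sp : ∀ w : ℝ, 0 ≤ w → SS (DD PP) w = hh (DD PP) 0 w + ∑' n, hh (DD PP) (n + 1) w := by
    intro w hw
    exact (summable_hh (DD PP) (by linarith)).tsum_eq_zero_add
  have su : ∀ w : ℝ, 0 ≤ w → Summable (fun n => hh (DD PP) (n + 1) w) := by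
    intro w hw
    exact (summable_nat_add_iff 1).2 (summable_hh (DD PP) (by linarith))
  have h := ((su v hv).neg.mul_right (hh PP 0 0)).tsum_le_tsum (fun n => tail_term n hv)
    ((su 0 le_rfl).neg.mul_right (hh PP 0 v))
  rw [tsum_mul_right, tsum_mul_right, tsum_neg, tsum_neg] at h
  have h0 := sp 0 le_rfl
  rw [SS_deriv_zero, hhD_ell 0 le_rfl] at h0
  have e0 : yy 0 0 = Real.pi := by simp [yy]
  rw [e0] at h0
  rw [sp v hv, hhD_ell 0 hv]
  have p0 := hhP_pos 0 (le_refl (0 : ℝ))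
  have pv := hhP_pos 0 hv
  have e1 : -∑' n, hh (DD PP) (n + 1) 0 = -ell Real.pi * hh PP 0 0 := by linarith
  rw [e1] at h
  have h2 : -∑' n, hh (DD PP) (n + 1) v ≤ -ell Real.pi * hh PP 0 v := by
    apply le_of_mul_le_mul_right _ p0
    linarith
  have := ell_pi
  nlinarith

lemma up_small {s : ℝ} (h0 : 0 ≤ s) (h1 : s ≤ 1 / 40) : -SS (DD PP) s ≤ 80 * s * SS PP s := by
  have key : ∀ n : ℕ, hh (DD PP) n 0 ≤ hh (DD PP) n s + 80 * s * hh PP n s := by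
    intro n
    have hder : ∀ v : ℝ, HasDerivAt (fun v => hh (DD PP) n v + 80 * v * hh PP n v)
        (hh (DD (DD PP)) n v + (80 * hh PP n v + 80 * v * hh (DD PP) n v)) v := by
      intro v
      have := (hasDerivAt_hh (DD PP) n v).add
        (((hasDerivAt_id v).const_mul 80).mul (hasDerivAt_hh PP n v))
      refine this.congr_deriv ?_
      simp
    have mono : MonotoneOn (fun v => hh (DD PP) n v + 80 * v * hh PP n v) (Icc 0 (1 / 40)) := by
      apply monotoneOn_of_deriv_nonneg (convex_Icc _ _)
      · exact fun v _ => (hder v).continuousAt.continuousWithinAt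
      · exact fun v _ => (hder v).differentiableAt.differentiableWithinAt
      · intro v hv
        rw [interior_Icc] at hv
        rw [(hder v).deriv, hhDD, hhP, hhD]
        have hy := yy_gt n hv.1.le
        obtain ⟨y, hyd⟩ : ∃ y, y = yy n v := ⟨_, rfl⟩
        have main : 0 ≤ 32 * y ^ 3 - 224 * y ^ 2 + 490 * y - 315 -
            80 * v * (8 * y ^ 2 - 30 * y + 15) := by
          have hv1 := hv.1
          have hv2 := hv.2
          rw [← hyd] at hy
          rcases n with _ | n
          · have l1 : Real.pi * (1 + 4 * v) ≤ y := by
              rw [hyd, yy_zero]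
              apply mul_le_mul_of_nonneg_left _ Real.pi_pos.le
              linarith [Real.add_one_le_exp (4 * v)]
            have l2 : y ≤ 3.48 := by
              rw [hyd, yy_zero]
              have : Real.exp (4 * v) ≤ 1.1055 := by
                have a : Real.exp (4 * v) ≤ Real.exp (1 / 10) := Real.exp_le_exp.2 (by linarith)
                have b := Real.exp_bound' (x := 1 / 10) (by norm_num) (by norm_num) (n := 3) (by norm_num)
                norm_num [Finset.sum_range_succ, Nat.factorial] at b
                linarith
              have := pi_hi
              nlinarith [Real.exp_pos (4 * v), Real.pi_pos]
            have l3 : 80 * v ≤ 6.3664 * (y - 3.14159) := by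
              have := pi_lo
              nlinarith
            have w0 : 0 ≤ 32 * y ^ 3 - 224 * y ^ 2 + 490 * y - 315 := by
              nlinarith [mul_nonneg (sub_nonneg.2 hy.le) (sub_nonneg.2 l2),
                mul_nonneg (sub_nonneg.2 hy.le) (sq_nonneg (y - 3.14159))]
            rcases le_total (8 * y ^ 2 - 30 * y + 15) 0 with hA | hA
            · nlinarith
            · have m := mul_le_mul_of_nonneg_right l3 hA
              have : 0 ≤ 32 * y ^ 3 - 224 * y ^ 2 + 490 * y - 315 -
                6.3664 * (y - 3.14159) * (8 * y ^ 2 - 30 * y + 15) := by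
                have s1 : 0 ≤ y - 3.14159 := by linarith
                have s2 : 0 ≤ 3.48 - y := by linarith
                nlinarith [mul_nonneg s1 s2, mul_nonneg s1 (mul_nonneg s1 s2),
                  mul_nonneg s2 (mul_nonneg s1 s2), mul_nonneg s1 (mul_nonneg s1 s1),
                  mul_nonneg s2 (mul_nonneg s2 s2)]
              linarith
          · have hy12 : 12 ≤ y := by
              have he : 1 ≤ Real.exp (4 * v) := Real.one_le_exp (by linarith)
              have hn : (4 : ℝ) ≤ (((n + 1 : ℕ) : ℝ) + 1) ^ 2 := by
                push_cast
                have : (0 : ℝ) ≤ n := by positivity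
                nlinarith
              have hp := pi_lo
              rw [hyd]; unfold yy
              have : 12 ≤ Real.pi * (((n + 1 : ℕ) : ℝ) + 1) ^ 2 := by nlinarith
              nlinarith
            have hA : 0 ≤ 8 * y ^ 2 - 30 * y + 15 := by nlinarith
            have m : 80 * v * (8 * y ^ 2 - 30 * y + 15) ≤ 2 * (8 * y ^ 2 - 30 * y + 15) :=
              mul_le_mul_of_nonneg_right (by linarith) hA
            nlinarith [mul_nonneg (sq_nonneg y) (sub_nonneg.2 hy12)]
        rw [← hyd] at hy ⊢
        have hy0 : 0 < y := by linarith
        have := mul_nonneg main (mul_pos hy0 (Real.exp_pos (v - y))).le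
        linarith
    have := mono (left_mem_Icc.2 (by norm_num)) ⟨h0, h1⟩ h0
    simpa using this
  have hs := summable_hh (DD PP) (v := s) (by linarith)
  have hs2 := (summable_hh PP (v := s) (by linarith)).mul_left (80 * s)
  have := (summable_hh (DD PP) (v := 0) (by norm_num)).tsum_le_tsum key (hs.add hs2)
  rw [hs.tsum_add hs2, tsum_mul_left] at this
  have z := SS_deriv_zero
  unfold SS at z ⊢
  linarith

lemma low1 {v : ℝ} (hv : 0 ≤ v) :
    v * (81 + 8 * v + 300 * v ^ 2) - (8 + 600 * v) / (81 + 8 * v + 300 * v ^ 2) ≤ ell (yy 0 v) := by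
  obtain ⟨Z, hZ⟩ : ∃ Z : ℝ, Z = 3.14159 * (1 + 4 * v + (4 * v) ^ 2 / 2 + (4 * v) ^ 3 / 6 +
    (4 * v) ^ 4 / 24 + (4 * v) ^ 5 / 120) := ⟨_, rfl⟩
  have hT := Real.sum_le_exp_of_nonneg (x := 4 * v) (by linarith) 6
  norm_num [Finset.sum_range_succ, Nat.factorial] at hT
  have hZy : Z ≤ yy 0 v := by
    rw [hZ, yy_zero]
    apply mul_le_mul pi_lo.le _ (by positivity) Real.pi_pos.le
    refine le_trans (le_of_eq ?_) hT
    ring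
  have hZ3 : 3.14159 ≤ Z := by
    rw [hZ]
    have : 0 ≤ 4 * v + (4 * v) ^ 2 / 2 + (4 * v) ^ 3 / 6 +
      (4 * v) ^ 4 / 24 + (4 * v) ^ 5 / 120 := by positivity
    linarith
  refine le_trans ?_ (ell_mono (by linarith) hZy)
  have hpol : 0 ≤ ((4 * Z - 9) * (2 * Z - 3) - 12) * (81 + 8 * v + 300 * v ^ 2) -
     (2 * Z - 3) * (v * ((81 + 8 * v + 300 * v ^ 2) * (81 + 8 * v + 300 * v ^ 2)) - (8 + 600 * v)) := by
    rw [hZ]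
    rcases le_total v 1 with h | h
    · have h1 : 0 ≤ 1 - v := by linarith
      have : 0 ≤ (3368234761 / 1250000000) * v ^ 0 * (1 - v) ^ 12 + (402412759617 / 312500000) * v ^ 1 * (1 - v) ^ 11 + (3657080785779 / 625000000) * v ^ 2 * (1 - v) ^ 10 + (48505569253901 / 937500000) * v ^ 3 * (1 - v) ^ 9 + (1118490676563601 / 3750000000) * v ^ 4 * (1 - v) ^ 8 + (2239162071110467 / 2343750000) * v ^ 5 * (1 - v) ^ 7 + (3183776578457037 / 1562500000) * v ^ 6 * (1 - v) ^ 6 + (26928354424826603 / 7031250000) * v ^ 7 * (1 - v) ^ 5 + (470940556713615619 / 56250000000) * v ^ 8 * (1 - v) ^ 4 + (267725375037086321 / 14062500000) * v ^ 9 * (1 - v) ^ 3 + (4325447619405341867 / 140625000000) * v ^ 10 * (1 - v) ^ 2 + (86073134361621707 / 2812500000) * v ^ 11 * (1 - v) ^ 1 + (4143467329251893741 / 281250000000) * v ^ 12 * (1 - v) ^ 0 := by positivity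
      refine this.trans (le_of_eq ?_)
      ring
    · obtain ⟨w, hw⟩ : ∃ w, w = v - 1 := ⟨_, rfl⟩
      have h1 : 0 ≤ w := by linarith
      have hvw : v = w + 1 := by linarith
      have : 0 ≤ (4143467329251893741 / 281250000000) * w ^ 0 + (2569643407178784637 / 17578125000) * w ^ 1 + (3123988186194196549 / 4687500000) * w ^ 2 + (1081906288195546553 / 585937500) * w ^ 3 + (1522287550056722726 / 439453125) * w ^ 4 + (10189987012157148199 / 2197265625) * w ^ 5 + (3327758315871985736 / 732421875) * w ^ 6 + (1441903577760265816 / 439453125) * w ^ 7 + (761076615746680216 / 439453125) * w ^ 8 + (285850235121869216 / 439453125) * w ^ 9 + (120513006352906784 / 732421875) * w ^ 10 + (55054929048396544 / 2197265625) * w ^ 11 + (50532289167872 / 29296875) * w ^ 12 := by positivity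
      refine this.trans (le_of_eq ?_)
      rw [hvw]
      ring
  have q0 : 0 < 81 + 8 * v + 300 * v ^ 2 := by positivity
  have z0 : 0 < 2 * Z - 3 := by linarith
  unfold ell
  rw [← sub_nonneg]
  have : 4 * Z - 9 - 12 / (2 * Z - 3) - (v * (81 + 8 * v + 300 * v ^ 2) - (8 + 600 * v) / (81 + 8 * v + 300 * v ^ 2))
    = (((4 * Z - 9) * (2 * Z - 3) - 12) * (81 + 8 * v + 300 * v ^ 2) -
     (2 * Z - 3) * (v * ((81 + 8 * v + 300 * v ^ 2) * (81 + 8 * v + 300 * v ^ 2)) - (8 + 600 * v))) /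
      ((2 * Z - 3) * (81 + 8 * v + 300 * v ^ 2)) := by
    have e : 12 / (2 * Z - 3) * (2 * Z - 3) = 12 := div_mul_cancel₀ _ z0.ne'
    have e2 : (8 + 600 * v) / (81 + 8 * v + 300 * v ^ 2) * (81 + 8 * v + 300 * v ^ 2) = 8 + 600 * v :=
      div_mul_cancel₀ _ q0.ne'
    rw [eq_div_iff (by positivity)]
    linear_combination (-(81 + 8 * v + 300 * v ^ 2)) * e + (2 * Z - 3) * e2
  rw [this]
  positivity

lemma up_mid {v : ℝ} (h1 : 1 / 40 ≤ v) (h2 : v ≤ 1 / 4) :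
    ell (yy 0 v) + 9 / 100 < v * (81 + 8 * v + 300 * v ^ 2) := by
  obtain ⟨Z, hZ⟩ : ∃ Z : ℝ, Z = 3.1416 * (1 + 4 * v + (4 * v) ^ 2 / 2 + (4 * v) ^ 3 / 6 +
    (4 * v) ^ 4 * (5 / 96)) := ⟨_, rfl⟩
  have hT := Real.exp_bound' (x := 4 * v) (by linarith) (by linarith) (n := 4) (by norm_num)
  norm_num [Finset.sum_range_succ, Nat.factorial] at hT
  have hv : 0 ≤ v := by linarith
  have hZy : yy 0 v ≤ Z := by
    rw [hZ, yy_zero]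
    apply mul_le_mul pi_hi.le _ (Real.exp_pos _).le (by norm_num)
    refine le_trans hT (le_of_eq ?_)
    ring
  have hy := yy_gt 0 hv
  refine lt_of_le_of_lt (add_le_add_left (ell_mono (by linarith) hZy) _) ?_
  have z0 : 0 < 2 * Z - 3 := by linarith
  have hpol : 0 < 12 - (4 * Z - 8.91 - v * (81 + 8 * v + 300 * v ^ 2)) * (2 * Z - 3) := by
    rw [hZ]
    have a1 : 0 ≤ v - 1 / 40 := by linarith
    have a2 : 0 ≤ 1 / 4 - v := by linarith
    rcases eq_or_lt_of_le a1 with h | h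
    · have : v = 1 / 40 := by linarith
      rw [this]; norm_num
    have : 0 < (13359889436713856 / 224201671875) * (v - 1 / 40) ^ 0 * (1 / 4 - v) ^ 8 + (278899481621863168 / 224201671875) * (v - 1 / 40) ^ 1 * (1 / 4 - v) ^ 7 + (2012896142760966656 / 224201671875) * (v - 1 / 40) ^ 2 * (1 / 4 - v) ^ 6 + (1362085019800116224 / 44840334375) * (v - 1 / 40) ^ 3 * (1 / 4 - v) ^ 5 + (509988443929278464 / 8968066875) * (v - 1 / 40) ^ 4 * (1 / 4 - v) ^ 4 + (113077186648395776 / 1793613375) * (v - 1 / 40) ^ 5 * (1 / 4 - v) ^ 3 + (14844661072781312 / 358722675) * (v - 1 / 40) ^ 6 * (1 / 4 - v) ^ 2 + (213147316142080 / 14348907) * (v - 1 / 40) ^ 7 * (1 / 4 - v) ^ 1 + (31831829970944 / 14348907) * (v - 1 / 40) ^ 8 * (1 / 4 - v) ^ 0 := by positivity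
    refine this.trans_le (le_of_eq ?_)
    ring
  unfold ell
  have : 4 * Z - 8.91 - v * (81 + 8 * v + 300 * v ^ 2) < 12 / (2 * Z - 3) := by
    rw [lt_div_iff₀ z0]; linarith
  linarith

lemma contS' : Continuous (fun u : ℝ => SS PP (Real.sqrt u)) := by
  rw [continuous_iff_continuousAt]
  intro u
  have h := (hasDerivAt_SS PP (v := Real.sqrt u) (by linarith [Real.sqrt_nonneg u])).continuousAt
  exact ContinuousAt.comp (f := Real.sqrt) h Real.continuous_sqrt.continuousAt

lemma hasDerivAt_sqrtS {u : ℝ} (hu : 0 < u) : HasDerivAt (fun u : ℝ => SS PP (Real.sqrt u))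
    (SS (DD PP) (Real.sqrt u) * (1 / (2 * Real.sqrt u))) u := by
  have h := (hasDerivAt_SS PP (v := Real.sqrt u) (by linarith [Real.sqrt_nonneg u]))
  exact h.comp u (Real.hasDerivAt_sqrt hu.ne')

lemma int_bound {t : ℝ} (ht : 0 < t) (c c' : ℝ → ℝ)
    (hc : ∀ v, Real.sqrt t ≤ v → HasDerivAt c (c' v) v) (hc0 : ∀ v, Real.sqrt t ≤ v → 0 ≤ c v)
    (hl : ∀ v, Real.sqrt t ≤ v → c' v - c v * ell (yy 0 v) ≤ -v) (R : ℝ) (hR : t ≤ R) :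
    ∫ u in t..R, SS PP (Real.sqrt u) ≤ 2 * c (Real.sqrt t) * SS PP (Real.sqrt t) := by
  have hst : 0 < Real.sqrt t := Real.sqrt_pos.2 ht
  have hder : ∀ x, t ≤ x → HasDerivAt
      (fun x => (∫ u in t..x, SS PP (Real.sqrt u)) + 2 * c (Real.sqrt x) * SS PP (Real.sqrt x))
      (SS PP (Real.sqrt x) + (2 * (c' (Real.sqrt x) * (1 / (2 * Real.sqrt x))) * SS PP (Real.sqrt x) +
        2 * c (Real.sqrt x) * (SS (DD PP) (Real.sqrt x) * (1 / (2 * Real.sqrt x))))) x := by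
    intro x hx
    have hx0 : 0 < x := by linarith
    have h1 : HasDerivAt (fun x => ∫ u in t..x, SS PP (Real.sqrt u)) (SS PP (Real.sqrt x)) x :=
      intervalIntegral.integral_hasDerivAt_right (contS'.intervalIntegrable _ _)
        (contS'.stronglyMeasurableAtFilter _ _) contS'.continuousAt
    have h2 : HasDerivAt (fun x => 2 * c (Real.sqrt x)) (2 * (c' (Real.sqrt x) * (1 / (2 * Real.sqrt x)))) x :=
      ((hc (Real.sqrt x) (Real.sqrt_le_sqrt hx)).comp x (Real.hasDerivAt_sqrt hx0.ne')).const_mul 2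
    exact h1.add (h2.mul (hasDerivAt_sqrtS hx0))
  have anti : AntitoneOn (fun x => (∫ u in t..x, SS PP (Real.sqrt u)) +
      2 * c (Real.sqrt x) * SS PP (Real.sqrt x)) (Ici t) := by
    apply antitoneOn_of_deriv_nonpos (convex_Ici _)
    · exact fun v hv => (hder v hv).continuousAt.continuousWithinAt
    · intro v hv
      rw [interior_Ici] at hv
      exact (hder v (le_of_lt hv)).differentiableAt.differentiableWithinAt
    · intro x hx
      rw [interior_Ici] at hx
      have hx' : t ≤ x := le_of_lt hx
      rw [(hder x hx').deriv]
      have hs := Real.sqrt_le_sqrt hx'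
      obtain ⟨s, hsd⟩ : ∃ s, s = Real.sqrt x := ⟨_, rfl⟩
      rw [← hsd] at hs ⊢
      have s0 : 0 < s := by linarith
      have a1 := low s0.le
      have a2 := hl s hs
      have a3 := hc0 s hs
      have a4 := SS_pos s0.le
      have e : SS PP s + (2 * (c' s * (1 / (2 * s))) * SS PP s +
          2 * c s * (SS (DD PP) s * (1 / (2 * s)))) =
          (s * SS PP s + c' s * SS PP s + c s * SS (DD PP) s) / s := by
        field_simp
        ring
      rw [e]
      apply div_nonpos_of_nonpos_of_nonneg _ s0.le
      have b1 := mul_le_mul_of_nonneg_left a1 a3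
      have b2 := mul_le_mul_of_nonneg_right a2 a4.le
      linarith
  have := anti self_mem_Ici hR hR
  simp only [intervalIntegral.integral_same, zero_add] at this
  have p1 := hc0 (Real.sqrt R) (Real.sqrt_le_sqrt hR)
  have p2 := SS_pos (Real.sqrt_nonneg R)
  have : 0 ≤ 2 * c (Real.sqrt R) * SS PP (Real.sqrt R) := by positivity
  linarith

lemma K_bound {t B : ℝ}
    (hB : ∀ R, t ≤ R → ∫ u in t..R, SS PP (Real.sqrt u) ≤ B) :
    MeasureTheory.IntegrableOn (fun u => SS PP (Real.sqrt u)) (Ioi t) ∧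
      ∫ u in Ioi t, SS PP (Real.sqrt u) ≤ B := by
  have hI : MeasureTheory.IntegrableOn (fun u => SS PP (Real.sqrt u)) (Ioi t) := by
    refine MeasureTheory.integrableOn_Ioi_of_intervalIntegral_norm_bounded B t (b := id) (l := atTop)
      (fun i => (contS'.integrableOn_Icc).mono_set Ioc_subset_Icc_self) tendsto_id ?_
    filter_upwards [eventually_ge_atTop t] with R hR
    have : ∀ u, ‖SS PP (Real.sqrt u)‖ = SS PP (Real.sqrt u) := fun u =>
      Real.norm_of_nonneg (SS_pos (Real.sqrt_nonneg u)).le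
    simp only [this]
    exact hB R hR
  refine ⟨hI, ?_⟩
  refine le_of_tendsto (MeasureTheory.intervalIntegral_tendsto_integral_Ioi t hI tendsto_id) ?_
  filter_upwards [eventually_ge_atTop t] with R hR
  exact hB R hR

lemma main_bound {t : ℝ} (ht : 0 < t) :
    ∃ C : ℝ, 0 < C ∧ (∀ R, t ≤ R → ∫ u in t..R, SS PP (Real.sqrt u) ≤ 2 * C * SS PP (Real.sqrt t)) ∧
      -SS (DD PP) (Real.sqrt t) * C < Real.sqrt t * SS PP (Real.sqrt t) := by
  have hs : 0 < Real.sqrt t := Real.sqrt_pos.2 ht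
  have hP := SS_pos hs.le
  rcases le_total (Real.sqrt t) (1 / 4) with h4 | h4
  · refine ⟨(81 + 8 * Real.sqrt t + 300 * Real.sqrt t ^ 2)⁻¹, by positivity, ?_, ?_⟩
    · refine int_bound ht (fun v => (81 + 8 * v + 300 * v ^ 2)⁻¹)
        (fun v => -(8 + 600 * v) / (81 + 8 * v + 300 * v ^ 2) ^ 2) ?_ ?_ ?_
      · intro v hv
        have v0 : 0 < v := by linarith
        have h := (((hasDerivAt_id v).const_mul 8).const_add 81).add (((hasDerivAt_id v).pow 2).const_mul 300)
        have h' : HasDerivAt (fun v : ℝ => 81 + 8 * v + 300 * v ^ 2) (8 + 600 * v) v := by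
          refine h.congr_deriv ?_
          simp; ring
        exact h'.inv (by positivity)
      · intro v hv
        have v0 : 0 < v := by linarith
        positivity
      · intro v hv
        have v0 : 0 < v := by linarith
        have hl := low1 v0.le
        have q0 : 0 < 81 + 8 * v + 300 * v ^ 2 := by positivity
        obtain ⟨q, hq⟩ : ∃ q, q = 81 + 8 * v + 300 * v ^ 2 := ⟨_, rfl⟩
        simp only [← hq] at hl q0 ⊢
        have : -(8 + 600 * v) / q ^ 2 - q⁻¹ * ell (yy 0 v) = -(ell (yy 0 v) + (8 + 600 * v) / q) / q := by
          field_simp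
          ring
        rw [this, div_le_iff₀ q0]
        linarith
    · have q0 : 0 < 81 + 8 * Real.sqrt t + 300 * Real.sqrt t ^ 2 := by positivity
      rw [← div_eq_mul_inv, div_lt_iff₀ q0]
      rcases le_total (Real.sqrt t) (1 / 40) with h1 | h1
      · have := up_small hs.le h1
        have : 80 * Real.sqrt t * SS PP (Real.sqrt t) <
            (Real.sqrt t * SS PP (Real.sqrt t)) * (81 + 8 * Real.sqrt t + 300 * Real.sqrt t ^ 2) := by
          have a : 0 < Real.sqrt t * SS PP (Real.sqrt t) := by positivity
          have b : 80 < 81 + 8 * Real.sqrt t + 300 * Real.sqrt t ^ 2 := by nlinarith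
          have := mul_lt_mul_of_pos_left b a
          linarith
        linarith
      · have a1 := up_tail hs.le
        have a2 := up_mid h1 h4
        have a3 := hh0_le_SS hs.le
        have a4 := hhP_pos 0 hs.le
        have a5 := mul_lt_mul_of_pos_right a2 a4
        have a6 := mul_le_mul_of_nonneg_left a3 (mul_pos hs q0).le
        linarith
  · have y8 : ∀ v, 1 / 4 ≤ v → 8 ≤ yy 0 v := by
      intro v hv
      rw [yy_zero]
      have : Real.exp 1 ≤ Real.exp (4 * v) := Real.exp_le_exp.2 (by linarith)
      have := Real.exp_one_gt_d9
      have := Real.pi_gt_three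
      nlinarith
    have hy := y8 _ h4
    refine ⟨Real.sqrt t / (4 * yy 0 (Real.sqrt t) - 8.91), div_pos hs (by linarith), ?_, ?_⟩
    · refine int_bound ht (fun v => v / (4 * yy 0 v - 8.91))
        (fun v => (1 * (4 * yy 0 v - 8.91) - v * (4 * (4 * yy 0 v))) / (4 * yy 0 v - 8.91) ^ 2) ?_ ?_ ?_
      · intro v hv
        have hy := y8 v (by linarith)
        exact (hasDerivAt_id v).div (((hasDerivAt_yy 0 v).const_mul 4).sub_const 8.91)
          (by intro h; linarith)
      · intro v hv
        have hy := y8 v (by linarith)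
        exact div_nonneg (by linarith) (by linarith)
      · intro v hv
        have hv4 : 1 / 4 ≤ v := by linarith
        have hy := y8 v hv4
        obtain ⟨y, hyd⟩ : ∃ y, y = yy 0 v := ⟨_, rfl⟩
        simp only [← hyd] at hy ⊢
        obtain ⟨m, hm⟩ : ∃ m, m = 4 * y - 8.91 := ⟨_, rfl⟩
        have m0 : 0 < m := by linarith
        have k1 : 12 / (2 * y - 3) * m ≤ 24 := by
          rw [div_mul_eq_mul_div, div_le_iff₀ (by linarith)]
          linarith
        have k2 : ell y = m - 9 / 100 - 12 / (2 * y - 3) := by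
          unfold ell; rw [hm]; ring
        rw [k2, ← hm]
        have : (1 * m - v * (4 * (4 * y))) / m ^ 2 - v / m * (m - 9 / 100 - 12 / (2 * y - 3)) =
          -v + (m - 16 * v * y + v * (9 / 100) * m + v * (12 / (2 * y - 3) * m)) / m ^ 2 := by
          generalize 12 / (2 * y - 3) = r
          field_simp
          ring
        rw [this]
        have : (m - 16 * v * y + v * (9 / 100) * m + v * (12 / (2 * y - 3) * m)) / m ^ 2 ≤ 0 := by
          apply div_nonpos_of_nonpos_of_nonneg _ (by positivity)
          have := mul_le_mul_of_nonneg_left k1 (show 0 ≤ v by linarith)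
          have k3 : 0 ≤ y * (15.64 * v - 4) + 8.91 - 24 * v := by
            rcases le_total 4 (15.64 * v) with h | h
            · nlinarith
            · have hyu : y ≤ 24 := by
                rw [hyd, yy_zero]
                have a1 : Real.exp (4 * v) ≤ Real.exp 1 * Real.exp 1 := by
                  rw [← Real.exp_add]; apply Real.exp_le_exp.2; linarith
                have a2 := Real.exp_one_lt_d9
                have a3 : Real.exp (4 * v) ≤ 7.5 := by nlinarith [Real.exp_pos 1]
                have := pi_hi
                nlinarith [Real.exp_pos (4 * v), Real.pi_pos]
              nlinarith
          rw [hm] at this ⊢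
          nlinarith
        linarith
    · have m0 : 0 < 4 * yy 0 (Real.sqrt t) - 8.91 := by linarith
      rw [mul_div_assoc', div_lt_iff₀ m0]
      have a1 := up_tail hs.le
      have a3 := hh0_le_SS hs.le
      have a4 := hhP_pos 0 hs.le
      have k2 : ell (yy 0 (Real.sqrt t)) + 9 / 100 < 4 * yy 0 (Real.sqrt t) - 8.91 := by
        have : 0 < 12 / (2 * yy 0 (Real.sqrt t) - 3) := div_pos (by norm_num) (by linarith)
        unfold ell; linarith
      have a5 := mul_lt_mul_of_pos_right k2 a4
      have a6 := mul_le_mul_of_nonneg_left a3 m0.le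
      have a7 : -SS (DD PP) (Real.sqrt t) < (4 * yy 0 (Real.sqrt t) - 8.91) * SS PP (Real.sqrt t) := by
        linarith
      have a8 := mul_lt_mul_of_pos_left a7 hs
      linarith

end JPhi

open JPhi in
/-- **Theorem 4.2 (a).** `log K_Φ(t)` is strictly concave for `t > 0`; that is,
`(d²/dt²) log K_Φ(t) < 0` for all `t > 0`. -/
theorem thm_4_2_a :
    ∀ t : ℝ, 0 < t → iteratedDeriv 2 (fun x => Real.log (KPhi x)) t < 0 := by
  intro t ht
  have hKe : ∀ x, KPhi x = ∫ u in Set.Ioi x, SS PP (Real.sqrt u) := by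
    intro x; unfold KPhi; simp only [jacobi_eq]
  have hIntg : ∀ x, 0 < x → MeasureTheory.IntegrableOn (fun u => SS PP (Real.sqrt u)) (Set.Ioi x) := by
    intro x hx
    obtain ⟨C, _, h, _⟩ := main_bound hx
    exact (K_bound h).1
  have hpos : ∀ x, 0 < x → 0 < KPhi x := by
    intro x hx
    rw [hKe]
    have hp : ∀ u, 0 < SS PP (Real.sqrt u) := fun u => SS_pos (Real.sqrt_nonneg u)
    rw [MeasureTheory.setIntegral_pos_iff_support_of_nonneg_ae
      (Filter.Eventually.of_forall fun u => (hp u).le) (hIntg x hx)]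
    have : Function.support (fun u => SS PP (Real.sqrt u)) = Set.univ := by
      ext u; simp [(hp u).ne']
    rw [this]; simp
  have hder : ∀ x, 0 < x → HasDerivAt KPhi (-SS PP (Real.sqrt x)) x := by
    intro x hx
    have h1 : HasDerivAt (fun y => (∫ u in Set.Ioi (x / 2), SS PP (Real.sqrt u)) -
        ∫ u in (x / 2)..y, SS PP (Real.sqrt u)) (-SS PP (Real.sqrt x)) x := by
      have := intervalIntegral.integral_hasDerivAt_right (contS'.intervalIntegrable (x / 2) x)
        (contS'.stronglyMeasurableAtFilter _ _) contS'.continuousAt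
      exact this.const_sub _
    refine h1.congr_of_eventuallyEq ?_
    filter_upwards [Ioi_mem_nhds (show x / 2 < x by linarith)] with y hy
    have hy' : x / 2 < y := hy
    rw [hKe, ← intervalIntegral.integral_Ioi_sub_Ioi (hIntg _ (by linarith)) hy'.le]
    ring
  have hlog : ∀ x, 0 < x → HasDerivAt (fun x => Real.log (KPhi x)) (-SS PP (Real.sqrt x) / KPhi x) x :=
    fun x hx => (hder x hx).log (hpos x hx).ne'
  have h2 : HasDerivAt (fun x => -SS PP (Real.sqrt x) / KPhi x)
      ((-(SS (DD PP) (Real.sqrt t) * (1 / (2 * Real.sqrt t))) * KPhi t -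
        -SS PP (Real.sqrt t) * -SS PP (Real.sqrt t)) / KPhi t ^ 2) t :=
    (hasDerivAt_sqrtS ht).neg.div (hder t ht) (hpos t ht).ne'
  rw [iteratedDeriv_succ, iteratedDeriv_one]
  have ev : deriv (fun x => Real.log (KPhi x)) =ᶠ[𝓝 t] (fun x => -SS PP (Real.sqrt x) / KPhi x) := by
    filter_upwards [Ioi_mem_nhds ht] with x hx
    exact (hlog x hx).deriv
  rw [ev.deriv_eq, h2.deriv]
  have hK := hpos t ht
  apply div_neg_of_neg_of_pos _ (by positivity)
  obtain ⟨C, hC, hb, hup⟩ := main_bound ht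
  have hKb := (K_bound hb).2
  rw [← hKe] at hKb
  have hs : 0 < Real.sqrt t := Real.sqrt_pos.2 ht
  have hP := SS_pos hs.le
  obtain ⟨s, hsd⟩ : ∃ s, s = Real.sqrt t := ⟨_, rfl⟩
  rw [← hsd] at hKb hs hP hup ⊢
  have e : -(SS (DD PP) s * (1 / (2 * s))) * KPhi t - -SS PP s * -SS PP s =
      (-SS (DD PP) s * KPhi t - 2 * s * SS PP s ^ 2) / (2 * s) := by
    field_simp
  rw [e]
  apply div_neg_of_neg_of_pos _ (by positivity)
  rcases le_total (-SS (DD PP) s) 0 with h | h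
  · have : -SS (DD PP) s * KPhi t ≤ 0 := mul_nonpos_of_nonpos_of_nonneg h hK.le
    have : 0 < 2 * s * SS PP s ^ 2 := by positivity
    linarith
  · have a := mul_le_mul_of_nonneg_left hKb h
    have b := mul_lt_mul_of_pos_right hup hP
    nlinarith
end
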